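/- (Parametric equivariant linearization at a fixed point.) Let k = k_e + k_h + 2k_f and let h : ℝ^{2k} → ℝ^k be the model moment map of Williamson type (k_e,k_h,k_f). Let G be a compact Lie group, D^m an open ball around 0 in ℝ^m, and ρ : G × D^m × ℝ^{2k} → ℝ^{2k} a smooth family of actions, i.e. for each fixed p ∈ D^m the map (g,z) ↦ ρ(g,p,z) =: ρ_p(g)(z) is a smooth action of G on ℝ^{2k}, such that for every g and p: ρ_p(g)(0) = 0, the derivative D(ρ_p(g))(z) is symplectic for every z, and h∘ρ_p(g) = h. Then there exist ε > 0 and a smooth map Φ : (D^m ∩ B(0,ε)) × B(0,ε) → ℝ^{2k}, writing Φ_p = Φ(p,·), with Φ_p(0) = 0, each Φ_p a diffeomorphism onto its image with DΦ_p(z) symplectic for all z, h∘Φ_p = h, and Φ_p(ρ_p(g)(z)) = D(ρ_0(g))(0)(Φ_p(z)) for every g ∈ G, p and every z ∈ B(0,ε) with ρ_p(g)(z) ∈ B(0,ε). That is, the parameter-dependent action is conjugated, by a smooth family of system-preserving symplectomorphisms, to the parameter-free linear action given by the linear parts at parameter 0. -/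

import Mathlib

open scoped BigOperators

/-- The standard symplectic form `ω = Σ_i dx_i ∧ dy_i` on `ℝ^{2k}`, modeled as
`Fin k → ℝ × ℝ` with `(x_i, y_i) = z i`. -/
def symplForm {k : ℕ} (u v : Fin k → ℝ × ℝ) : ℝ :=
  ∑ i : Fin k, ((u i).1 * (v i).2 - (u i).2 * (v i).1)

/-- A continuous linear map on `ℝ^{2k}` is symplectic if it preserves `ω`. -/
def IsSymplecticCLM {k : ℕ} (A : (Fin k → ℝ × ℝ) →L[ℝ] (Fin k → ℝ × ℝ)) : Prop :=
  ∀ u v, symplForm (A u) (A v) = symplForm u v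

/-- The `i`-th component of the model moment map of Williamson type `(k_e, k_h, k_f)`
(with `k = k_e + k_h + 2 k_f`): elliptic components `x_i² + y_i²` for `i < k_e`,
hyperbolic components `x_i y_i` for `k_e ≤ i < k_e + k_h`, and focus-focus pairs
`x_i y_{i+1} − x_{i+1} y_i`, `x_i y_i + x_{i+1} y_{i+1}` for the remaining indices,
grouped in consecutive pairs.  (Indices are 0-based.) -/
def williamson (ke kh : ℕ) {k : ℕ} (i : Fin k) (z : Fin k → ℝ × ℝ) : ℝ :=
  let x : ℕ → ℝ := fun j => if h : j < k then (z ⟨j, h⟩).1 else 0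
  let y : ℕ → ℝ := fun j => if h : j < k then (z ⟨j, h⟩).2 else 0
  if i.val < ke then x i.val ^ 2 + y i.val ^ 2
  else if i.val < ke + kh then x i.val * y i.val
  else if (i.val - (ke + kh)) % 2 = 0 then
    x i.val * y (i.val + 1) - x (i.val + 1) * y i.val
  else x (i.val - 1) * y (i.val - 1) + x i.val * y i.val

section

open MeasureTheory Set Topology Filter ComplexConjugate

/-- Differentiation under an interval integral whose integrand is `C^∞` in parameter and time. -/
theorem hasFDerivAt_intervalIntegral_of_contDiffOn {H E : Type} [NormedAddCommGroup H]
    [NormedSpace ℝ H] [ProperSpace H] [NormedAddCommGroup E] [NormedSpace ℝ E]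
    {U : Set H} (hU : IsOpen U) {F : H × ℝ → E}
    (hF : ContDiffOn ℝ (⊤ : ℕ∞) F (U ×ˢ univ)) {x₀ : H} (hx₀ : x₀ ∈ U) :
    HasFDerivAt (fun x => ∫ t in (0 : ℝ)..1, F (x, t))
      (∫ t in (0 : ℝ)..1, (fderiv ℝ F (x₀, t)).comp (ContinuousLinearMap.inl ℝ H ℝ)) x₀ := by
  have hopen : IsOpen (U ×ˢ (univ : Set ℝ)) := hU.prod isOpen_univ
  have hslice : ∀ x ∈ U, Continuous fun t : ℝ => F (x, t) := fun x hx =>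
    hF.continuousOn.comp_continuous (by fun_prop) fun t => ⟨hx, trivial⟩
  have hderiv : ContinuousOn
      (fun q : H × ℝ => (fderiv ℝ F q).comp (ContinuousLinearMap.inl ℝ H ℝ)) (U ×ˢ univ) :=
    (hF.continuousOn_fderiv_of_isOpen hopen (by simp)).clm_comp continuousOn_const
  obtain ⟨δ, hδ, hball⟩ := Metric.nhds_basis_closedBall.mem_iff.1 (hU.mem_nhds hx₀)
  have hcomp : IsCompact (Metric.closedBall x₀ δ ×ˢ Icc (0 : ℝ) 1) :=
    (isCompact_closedBall x₀ δ).prod isCompact_Icc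
  obtain ⟨C, hC⟩ := hcomp.exists_bound_of_continuousOn
    (hderiv.mono (prod_mono hball (subset_univ _)))
  refine intervalIntegral.hasFDerivAt_integral_of_dominated_of_fderiv_le
    (F := fun x t => F (x, t)) (s := Metric.closedBall x₀ δ) (bound := fun _ => C)
    (F' := fun x t => (fderiv ℝ F (x, t)).comp (ContinuousLinearMap.inl ℝ H ℝ))
    (Metric.closedBall_mem_nhds x₀ hδ) ?_ ?_ ?_ ?_ ?_ ?_
  · filter_upwards [hU.mem_nhds hx₀] with x hx
    exact (hslice x hx).aestronglyMeasurable
  · exact (hslice x₀ hx₀).intervalIntegrable _ _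
  · exact (hderiv.comp_continuous (f := fun t : ℝ => (x₀, t)) (by fun_prop)
      fun t => ⟨hx₀, trivial⟩).aestronglyMeasurable
  · refine Eventually.of_forall fun t ht x hx => hC (x, t) ⟨hx, ?_⟩
    rw [uIoc_of_le zero_le_one] at ht
    exact ⟨ht.1.le, ht.2⟩
  · exact intervalIntegrable_const
  · refine Eventually.of_forall fun t _ x hx => ?_
    have hd : HasFDerivAt F (fderiv ℝ F (x, t)) (x, t) :=
      ((hF.differentiableOn (by simp)).differentiableAt
        (hopen.mem_nhds ⟨hball hx, trivial⟩)).hasFDerivAt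
    exact hd.comp x (hasFDerivAt_prodMk_left x t)

/-- An interval integral is `C^∞` in a parameter if the integrand is `C^∞`. -/
theorem contDiffOn_intervalIntegral {H E : Type} [NormedAddCommGroup H]
    [NormedSpace ℝ H] [ProperSpace H] [NormedAddCommGroup E] [NormedSpace ℝ E]
    {U : Set H} (hU : IsOpen U) {F : H × ℝ → E} (hF : ContDiffOn ℝ (⊤ : ℕ∞) F (U ×ˢ univ)) :
    ContDiffOn ℝ (⊤ : ℕ∞) (fun x => ∫ t in (0 : ℝ)..1, F (x, t)) U := by
  rw [contDiffOn_infty]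
  intro n
  induction n generalizing E with
  | zero =>
    exact contDiffOn_zero.2 fun x hx =>
      (hasFDerivAt_intervalIntegral_of_contDiffOn hU hF hx).continuousAt.continuousWithinAt
  | succ n ih =>
    have hopen : IsOpen (U ×ˢ (univ : Set ℝ)) := hU.prod isOpen_univ
    have hderiv : ContDiffOn ℝ (⊤ : ℕ∞)
        (fun q : H × ℝ => (fderiv ℝ F q).comp (ContinuousLinearMap.inl ℝ H ℝ)) (U ×ˢ univ) :=
      (hF.fderiv_of_isOpen hopen (by simp)).clm_comp contDiffOn_const
    push_cast
    rw [contDiffOn_succ_iff_fderiv_of_isOpen hU]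
    refine ⟨fun x hx => (hasFDerivAt_intervalIntegral_of_contDiffOn hU hF
      hx).differentiableAt.differentiableWithinAt, by simp, (ih hderiv).congr fun x hx => ?_⟩
    exact (hasFDerivAt_intervalIntegral_of_contDiffOn hU hF hx).fderiv

/-- The multiplicative group of a normed field has no small subgroups. -/
theorem eq_one_of_norm_pow_sub_one_le {w : ℂ} (h : ∀ n : ℕ, ‖w ^ n - 1‖ ≤ 1 / 2) : w = 1 := by
  have hgrow : ∀ n : ℕ, (3 / 2 : ℝ) ^ n * ‖w - 1‖ ≤ ‖w ^ 2 ^ n - 1‖ := by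
    intro n
    induction n with
    | zero => simp
    | succ n ih =>
      have hfac : w ^ 2 ^ (n + 1) - 1 = (w ^ 2 ^ n - 1) * (2 + (w ^ 2 ^ n - 1)) := by ring
      have hbig : (3 / 2 : ℝ) ≤ ‖2 + (w ^ 2 ^ n - 1)‖ := by
        have := norm_sub_norm_le (2 : ℂ) (-(w ^ 2 ^ n - 1))
        rw [norm_neg, sub_neg_eq_add] at this
        have h2 : ‖(2 : ℂ)‖ = 2 := by simp
        linarith [h (2 ^ n)]
      rw [hfac, norm_mul, pow_succ]
      nlinarith [norm_nonneg (w ^ 2 ^ n - 1), norm_nonneg (w - 1)]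
  by_contra hne
  have hpos : 0 < ‖w - 1‖ := norm_pos_iff.2 (sub_ne_zero.2 hne)
  obtain ⟨n, hn⟩ := pow_unbounded_of_one_lt (1 / ‖w - 1‖) (by norm_num : (1 : ℝ) < 3 / 2)
  rw [div_lt_iff₀ hpos] at hn
  linarith [hgrow n, h (2 ^ n)]

/-- The three kinds of blocks of a nondegenerate quadratic integrable system. -/
inductive BlockKind where
  | elliptic
  | hyperbolic
  | focus

namespace BlockKind

/-- The real subspace of `ℂ × ℂ` occupied by a block. -/
def Admissible : BlockKind → ℂ × ℂ → Prop
  | elliptic, w => w.2 = ((-1 / 2 : ℝ) : ℂ) * (Complex.I * w.1)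
  | hyperbolic, w => w.1.im = 0 ∧ w.2.im = 0
  | focus, _ => True

/-- The Lie algebra of the group acting on a block. -/
def IsInfinitesimal : BlockKind → ℂ → Prop
  | elliptic, θ => θ.re = 0
  | hyperbolic, θ => θ.im = 0
  | focus, _ => True

/-- The group of multipliers acting on a block by `(ξ, η) ↦ (c ξ, η / conj c)`. -/
def IsMultiplier : BlockKind → ℂ → Prop
  | elliptic, c => conj c * c = 1
  | hyperbolic, c => c ≠ 0 ∧ c.im = 0
  | focus, c => c ≠ 0

/-- The identity component of the group of multipliers. -/
def IsPositive (κ : BlockKind) (c : ℂ) : Prop :=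
  κ.IsMultiplier c ∧ (κ = hyperbolic → 0 < c.re)

variable {κ : BlockKind} {c d θ : ℂ} {w w' : ℂ × ℂ}

theorem Admissible.zero : κ.Admissible 0 := by
  cases κ <;> simp [Admissible]

theorem IsMultiplier.ne_zero (h : κ.IsMultiplier c) : c ≠ 0 := by
  rintro rfl
  cases κ <;> simp [IsMultiplier] at h

theorem IsMultiplier.conj_ne_zero (h : κ.IsMultiplier c) : conj c ≠ 0 :=
  (map_ne_zero _).2 h.ne_zero

theorem IsMultiplier.mul (hc : κ.IsMultiplier c) (hd : κ.IsMultiplier d) :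
    κ.IsMultiplier (c * d) := by
  cases κ
  · simp only [IsMultiplier, map_mul] at *
    linear_combination conj d * d * hc + hd
  · exact ⟨mul_ne_zero hc.1 hd.1, by simp [hc.2, hd.2]⟩
  · exact mul_ne_zero hc hd

theorem IsMultiplier.inv (hc : κ.IsMultiplier c) : κ.IsMultiplier c⁻¹ := by
  cases κ
  · simp only [IsMultiplier, map_inv₀] at *
    rw [← mul_inv, hc, inv_one]
  · exact ⟨inv_ne_zero hc.1, by simp [Complex.inv_im, hc.2]⟩
  · exact inv_ne_zero (a := c) hc

theorem Admissible.act (hw : κ.Admissible w) (hc : κ.IsMultiplier c) :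
    κ.Admissible (c * w.1, (conj c)⁻¹ * w.2) := by
  cases κ
  · have h : (conj c)⁻¹ = c := inv_eq_of_mul_eq_one_right hc
    simp only [Admissible] at *
    rw [h, hw]
    ring
  · obtain ⟨h1, h2⟩ := hw
    obtain ⟨-, h3⟩ := hc
    simp [Admissible, h1, h2, h3]
  · trivial

theorem Admissible.lie (hw : κ.Admissible w) (hθ : κ.IsInfinitesimal θ) :
    κ.Admissible (θ * w.1, -conj θ * w.2) := by
  cases κ
  · have h : conj θ = -θ := by
      apply Complex.ext <;> simp [show θ.re = 0 from hθ]
    simp only [Admissible] at *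
    rw [h, hw]
    ring
  · obtain ⟨h1, h2⟩ := hw
    simp [Admissible, h1, h2, show θ.im = 0 from hθ]
  · trivial

theorem IsInfinitesimal.zero : κ.IsInfinitesimal 0 := by
  cases κ <;> simp [IsInfinitesimal]

theorem IsInfinitesimal.add {θ' : ℂ} (h : κ.IsInfinitesimal θ) (h' : κ.IsInfinitesimal θ') :
    κ.IsInfinitesimal (θ + θ') := by
  cases κ <;> simp_all [IsInfinitesimal]

theorem IsInfinitesimal.real_mul (h : κ.IsInfinitesimal θ) (s : ℝ) :
    κ.IsInfinitesimal ((s : ℂ) * θ) := by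
  cases κ <;> simp_all [IsInfinitesimal]

theorem IsInfinitesimal.sub {θ' : ℂ} (h : κ.IsInfinitesimal θ) (h' : κ.IsInfinitesimal θ') :
    κ.IsInfinitesimal (θ - θ') := by
  cases κ <;> simp_all [IsInfinitesimal]

theorem IsInfinitesimal.sum {α : Type*} (s : Finset α) {θ : α → ℂ}
    (h : ∀ a ∈ s, κ.IsInfinitesimal (θ a)) : κ.IsInfinitesimal (∑ a ∈ s, θ a) :=
  Finset.sum_induction _ _ (fun _ _ => IsInfinitesimal.add) IsInfinitesimal.zero h

theorem IsInfinitesimal.exp (h : κ.IsInfinitesimal θ) : κ.IsPositive (Complex.exp θ) := by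
  refine ⟨?_, ?_⟩
  · cases κ
    · have h' : conj θ + θ = 0 := by
        apply Complex.ext <;> simp [show θ.re = 0 from h]
      simp [IsMultiplier, ← Complex.exp_conj, ← Complex.exp_add, h']
    · exact ⟨Complex.exp_ne_zero _, by simp [Complex.exp_im, show θ.im = 0 from h]⟩
    · exact Complex.exp_ne_zero θ
  · rintro rfl
    simp [Complex.exp_re, show θ.im = 0 from h, Real.exp_pos]

theorem IsPositive.log (h : κ.IsPositive c) : κ.IsInfinitesimal (Complex.log c) := by
  obtain ⟨h, h'⟩ := h
  cases κ
  · have hn : ‖c‖ ^ 2 = 1 := by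
      have := h
      simp only [IsMultiplier, Complex.conj_mul'] at this
      exact_mod_cast this
    have hn' : ‖c‖ = 1 := by nlinarith [norm_nonneg c]
    simp [IsInfinitesimal, Complex.log_re, hn']
  · have := Complex.arg_eq_zero_iff.2 ⟨(h' rfl).le, h.2⟩
    simpa [IsInfinitesimal, Complex.log_im] using this
  · trivial

end BlockKind

/-- A real vector space split into blocks, realised inside `ι → ℂ × ℂ`. -/
structure BlockModel (ι V : Type) [Fintype ι] [NormedAddCommGroup V] [NormedSpace ℝ V] where
  /-- The kind of each block. -/
  kind : ι → BlockKind
  /-- The complex block coordinates. -/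
  toC : V →L[ℝ] (ι → ℂ × ℂ)
  /-- Reconstruction of a vector from its block coordinates. -/
  ofC : (ι → ℂ × ℂ) →L[ℝ] V
  ofC_toC : ∀ z, ofC (toC z) = z
  toC_ofC : ∀ w, (∀ i, (kind i).Admissible (w i)) → toC (ofC w) = w
  admissible : ∀ z i, (kind i).Admissible (toC z i)

namespace BlockModel

variable {ι V : Type} [Fintype ι] [NormedAddCommGroup V] [NormedSpace ℝ V] (M : BlockModel ι V)

/-- First complex coordinate of a block. -/
noncomputable def xi (i : ι) : V →L[ℝ] ℂ :=
  (ContinuousLinearMap.fst ℝ ℂ ℂ).comp ((ContinuousLinearMap.proj i).comp M.toC)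

/-- Second complex coordinate of a block. -/
noncomputable def eta (i : ι) : V →L[ℝ] ℂ :=
  (ContinuousLinearMap.snd ℝ ℂ ℂ).comp ((ContinuousLinearMap.proj i).comp M.toC)

/-- The symplectic form. -/
noncomputable def omega (u v : V) : ℝ :=
  ∑ i, (conj (M.xi i u) * M.eta i v - conj (M.eta i u) * M.xi i v).re

/-- The complex momentum of a block. -/
noncomputable def mom (i : ι) (z : V) : ℂ := conj (M.xi i z) * M.eta i z

/-- The action of a family of multipliers. -/
noncomputable def act (c : ι → ℂ) (z : V) : V :=
  M.ofC fun i => (c i * M.xi i z, (conj (c i))⁻¹ * M.eta i z)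

/-- The infinitesimal action. -/
noncomputable def lie (θ : ι → ℂ) (z : V) : V :=
  M.ofC fun i => (θ i * M.xi i z, -conj (θ i) * M.eta i z)

variable {M}

theorem ext_coord {z z' : V} (h : ∀ i, M.xi i z = M.xi i z') (h' : ∀ i, M.eta i z = M.eta i z') :
    z = z' := by
  rw [← M.ofC_toC z, ← M.ofC_toC z']
  congr 1
  funext i
  exact Prod.ext (h i) (h' i)

theorem xi_ofC {w : ι → ℂ × ℂ} (hw : ∀ i, (M.kind i).Admissible (w i)) (i : ι) :
    M.xi i (M.ofC w) = (w i).1 := by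
  simp [xi, M.toC_ofC w hw]

theorem eta_ofC {w : ι → ℂ × ℂ} (hw : ∀ i, (M.kind i).Admissible (w i)) (i : ι) :
    M.eta i (M.ofC w) = (w i).2 := by
  simp [eta, M.toC_ofC w hw]

theorem admissible_coord (z : V) (i : ι) : (M.kind i).Admissible (M.xi i z, M.eta i z) :=
  M.admissible z i

variable {c d θ : ι → ℂ}

theorem xi_act (hc : ∀ i, (M.kind i).IsMultiplier (c i)) (z : V) (i : ι) :
    M.xi i (M.act c z) = c i * M.xi i z :=
  xi_ofC (fun i => (admissible_coord z i).act (hc i)) i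

theorem eta_act (hc : ∀ i, (M.kind i).IsMultiplier (c i)) (z : V) (i : ι) :
    M.eta i (M.act c z) = (conj (c i))⁻¹ * M.eta i z :=
  eta_ofC (fun i => (admissible_coord z i).act (hc i)) i

theorem xi_lie (hθ : ∀ i, (M.kind i).IsInfinitesimal (θ i)) (z : V) (i : ι) :
    M.xi i (M.lie θ z) = θ i * M.xi i z :=
  xi_ofC (fun i => (admissible_coord z i).lie (hθ i)) i

theorem eta_lie (hθ : ∀ i, (M.kind i).IsInfinitesimal (θ i)) (z : V) (i : ι) :
    M.eta i (M.lie θ z) = -conj (θ i) * M.eta i z :=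
  eta_ofC (fun i => (admissible_coord z i).lie (hθ i)) i

/-- The vector supported in a single block. -/
noncomputable def single [DecidableEq ι] (M : BlockModel ι V) (i : ι) (w : ℂ × ℂ) : V :=
  M.ofC (Pi.single i w)

theorem admissible_single [DecidableEq ι] {i : ι} {w : ℂ × ℂ} (hw : (M.kind i).Admissible w)
    (j : ι) : (M.kind j).Admissible ((Pi.single i w : ι → ℂ × ℂ) j) := by
  rcases eq_or_ne j i with rfl | h
  · simpa using hw
  · simpa [h] using BlockKind.Admissible.zero

theorem xi_single [DecidableEq ι] {i : ι} {w : ℂ × ℂ} (hw : (M.kind i).Admissible w) (j : ι) :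
    M.xi j (M.single i w) = ((Pi.single i w : ι → ℂ × ℂ) j).1 :=
  xi_ofC (admissible_single hw) j

theorem eta_single [DecidableEq ι] {i : ι} {w : ℂ × ℂ} (hw : (M.kind i).Admissible w) (j : ι) :
    M.eta j (M.single i w) = ((Pi.single i w : ι → ℂ × ℂ) j).2 :=
  eta_ofC (admissible_single hw) j

theorem omega_nondegenerate {x : V} (h : ∀ v, M.omega x v = 0) : x = 0 := by
  let w : ι → ℂ × ℂ := fun i => match M.kind i with
    | .elliptic => (Complex.I * M.xi i x, ((1 / 2 : ℝ) : ℂ) * M.xi i x)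
    | _ => (-M.eta i x, M.xi i x)
  have hw : ∀ i, (M.kind i).Admissible (w i) := by
    intro i
    have hx := admissible_coord (M := M) x i
    simp only [w]
    cases hκ : M.kind i
    · simp only [BlockKind.Admissible]
      push_cast
      linear_combination ((1 / 2) * M.xi i x) * Complex.I_mul_I
    · rw [hκ] at hx
      exact ⟨by simpa using hx.2, hx.1⟩
    · trivial
  have hterm : ∀ i, Complex.normSq (M.xi i x) + Complex.normSq (M.eta i x) ≤
      2 * (conj (M.xi i x) * (w i).2 - conj (M.eta i x) * (w i).1).re := by
    intro i
    have hx := admissible_coord (M := M) x i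
    simp only [w]
    cases hκ : M.kind i
    · rw [hκ] at hx
      have hx' : M.eta i x = ((-1 / 2 : ℝ) : ℂ) * (Complex.I * M.xi i x) := hx
      have key : ∀ (r s : ℝ) (a : ℂ), (conj a * (s * a) - conj (r * (Complex.I * a)) *
          (Complex.I * a)).re = (s - r) * Complex.normSq a := by
        intro r s a
        simp [Complex.normSq_apply]
        ring
      rw [hx', key, map_mul, map_mul, Complex.normSq_ofReal, Complex.normSq_I]
      nlinarith [Complex.normSq_nonneg (M.xi i x)]
    · simp only [Complex.normSq_apply]
      simp
      nlinarith [sq_nonneg (M.xi i x).re, sq_nonneg (M.xi i x).im, sq_nonneg (M.eta i x).re,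
        sq_nonneg (M.eta i x).im]
    · simp only [Complex.normSq_apply]
      simp
      nlinarith [sq_nonneg (M.xi i x).re, sq_nonneg (M.xi i x).im, sq_nonneg (M.eta i x).re,
        sq_nonneg (M.eta i x).im]
  have hsum := h (M.ofC w)
  simp only [omega, xi_ofC hw, eta_ofC hw] at hsum
  have hnn : ∀ i ∈ Finset.univ,
      0 ≤ (conj (M.xi i x) * (w i).2 - conj (M.eta i x) * (w i).1).re := fun i _ => by
    linarith [hterm i, Complex.normSq_nonneg (M.xi i x), Complex.normSq_nonneg (M.eta i x)]
  have hzero := (Finset.sum_eq_zero_iff_of_nonneg hnn).1 hsum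
  have hboth : ∀ i, M.xi i x = 0 ∧ M.eta i x = 0 := fun i => by
    have h1 := hterm i
    rw [hzero i (Finset.mem_univ i)] at h1
    have h2 := Complex.normSq_nonneg (M.xi i x)
    have h3 := Complex.normSq_nonneg (M.eta i x)
    exact ⟨Complex.normSq_eq_zero.1 (by linarith), Complex.normSq_eq_zero.1 (by linarith)⟩
  exact ext_coord (M := M) (fun i => by simp [(hboth i).1]) fun i => by simp [(hboth i).2]

theorem omega_sub_left (u u' v : V) : M.omega (u - u') v = M.omega u v - M.omega u' v := by
  simp only [omega, ← Finset.sum_sub_distrib]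
  exact Finset.sum_congr rfl fun i _ => by simp; ring

theorem bijective_of_omega [FiniteDimensional ℝ V] {A : V →L[ℝ] V}
    (hA : ∀ u v, M.omega (A u) (A v) = M.omega u v) : Function.Surjective A := by
  have hinj : Function.Injective (A : V →ₗ[ℝ] V) := by
    refine (injective_iff_map_eq_zero _).2 fun x hx => omega_nondegenerate (M := M) fun v => ?_
    rw [← hA, show A x = 0 from hx]
    simp [omega]
  exact LinearMap.surjective_of_injective hinj

theorem hasFDerivAt_mom {E : Type} [NormedAddCommGroup E] [NormedSpace ℝ E] {f : E → V}
    {f' : E →L[ℝ] V} {z : E} (hf : HasFDerivAt f f' z) (i : ι) (v : E) :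
    lineDeriv ℝ (fun z => M.mom i (f z)) z v =
      conj (M.xi i (f z)) * M.eta i (f' v) + conj (M.xi i (f' v)) * M.eta i (f z) := by
  have h1 := (Complex.conjCLE.toContinuousLinearMap.hasFDerivAt.comp z
    ((M.xi i).hasFDerivAt.comp z hf)).mul ((M.eta i).hasFDerivAt.comp z hf)
  have h2 := h1.hasLineDerivAt v
  refine Eq.trans h2.lineDeriv ?_
  simp
  ring

/-- A symplectic map preserving the momenta intertwines the infinitesimal action. -/
theorem fderiv_lie [FiniteDimensional ℝ V] {f : V → V} {z : V} (hf : DifferentiableAt ℝ f z)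
    (hsymp : ∀ u v, M.omega (fderiv ℝ f z u) (fderiv ℝ f z v) = M.omega u v)
    (hmom : ∀ i z, M.mom i (f z) = M.mom i z) (hθ : ∀ i, (M.kind i).IsInfinitesimal (θ i)) :
    fderiv ℝ f z (M.lie θ z) = M.lie θ (f z) := by
  rw [← sub_eq_zero]
  refine omega_nondegenerate (M := M) fun y => ?_
  obtain ⟨v, rfl⟩ := bijective_of_omega hsymp y
  rw [omega_sub_left, hsymp, sub_eq_zero]
  simp only [omega, xi_lie hθ, eta_lie hθ]
  refine Finset.sum_congr rfl fun i _ => ?_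
  have h1 := hasFDerivAt_mom (M := M) hf.hasFDerivAt i v
  simp only [hmom] at h1
  have h2 := h1.symm.trans (hasFDerivAt_mom (M := M) (hasFDerivAt_id z) i v)
  simp only [ContinuousLinearMap.id_apply, id] at h2
  have key : ∀ a b a' b' t : ℂ, (conj (t * a) * b' - conj (-conj t * b) * a').re =
      (conj t * (conj a * b' + conj a' * b)).re := by
    intro a b a' b' t
    simp
    ring
  rw [key, key, h2]

/-- A symplectic diffeomorphism preserving the momenta commutes with the identity component
of the group of multipliers. -/
theorem map_act [FiniteDimensional ℝ V] {f : V → V} (hf : Differentiable ℝ f)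
    (hsymp : ∀ z u v, M.omega (fderiv ℝ f z u) (fderiv ℝ f z v) = M.omega u v)
    (hmom : ∀ i z, M.mom i (f z) = M.mom i z) (hc : ∀ i, (M.kind i).IsPositive (c i)) (z : V) :
    f (M.act c z) = M.act c (f z) := by
  set θ : ι → ℂ := fun i => Complex.log (c i) with hθdef
  have hθ : ∀ i, (M.kind i).IsInfinitesimal (θ i) := fun i => (hc i).log
  let e : ℝ → ι → ℂ := fun s i => Complex.exp (s * θ i)
  have he : ∀ s i, (M.kind i).IsMultiplier (e s i) := fun s i => ((hθ i).real_mul s).exp.1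
  have hder : ∀ s i, HasDerivAt (fun s : ℝ => e s i) (θ i * e s i) s := by
    intro s i
    have := ((Complex.ofRealCLM.hasDerivAt (x := s)).mul_const (θ i)).cexp
    simpa [e, mul_comm] using this
  have hcurve : ∀ s, HasDerivAt (fun s => M.act (e s) z) (M.lie θ (M.act (e s) z)) s := by
    intro s
    refine M.ofC.hasFDerivAt.comp_hasDerivAt s (hasDerivAt_pi.2 fun i => ?_)
    rw [xi_act (he s), eta_act (he s)]
    refine HasDerivAt.prodMk ?_ ?_
    · simpa [mul_assoc] using (hder s i).mul_const (M.xi i z)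
    · have hconj : ∀ s, (conj (e s i))⁻¹ = Complex.exp (s * (-conj (θ i))) := fun s => by
        simp only [e]
        rw [← Complex.exp_conj, ← Complex.exp_neg]
        simp
      have h1 : HasDerivAt (fun s : ℝ => (conj (e s i))⁻¹)
          (-conj (θ i) * (conj (e s i))⁻¹) s := by
        simp only [hconj]
        have := ((Complex.ofRealCLM.hasDerivAt (x := s)).mul_const (-conj (θ i))).cexp
        simpa [mul_comm] using this
      simpa [mul_assoc] using h1.mul_const (M.eta i z)
  have hfcurve : ∀ s, HasDerivAt (fun s => f (M.act (e s) z))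
      (M.lie θ (f (M.act (e s) z))) s := by
    intro s
    have := (hf (M.act (e s) z)).hasFDerivAt.comp_hasDerivAt s (hcurve s)
    rwa [fderiv_lie (hf _) (hsymp _) hmom hθ] at this
  have hone : ∀ z, M.act (e 0) z = z := fun z =>
    ext_coord (M := M) (fun i => by rw [xi_act (he 0)]; simp [e])
      fun i => by rw [eta_act (he 0)]; simp [e]
  have hec : e 1 = c := by
    funext i
    simp [e, θ, Complex.exp_log (hc i).1.ne_zero]
  have hconst : ∀ (g : ℝ → ℂ) (a : ℂ), (∀ s, HasDerivAt g (a * g s) s) →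
      g 1 = Complex.exp a * g 0 := by
    intro g a hg
    have h1 : ∀ s : ℝ, HasDerivAt (fun s : ℝ => Complex.exp (s * (-a)) * g s) 0 s := by
      intro s
      have h2 := ((Complex.ofRealCLM.hasDerivAt (x := s)).mul_const (-a)).cexp.mul (hg s)
      refine h2.congr_deriv ?_
      simp
      ring
    have h3 := is_const_of_deriv_eq_zero (fun s => (h1 s).differentiableAt)
      (fun s => (h1 s).deriv) 1 0
    simp only [Complex.ofReal_one, one_mul, Complex.ofReal_zero, zero_mul, Complex.exp_zero] at h3
    rw [← h3, ← mul_assoc, ← Complex.exp_add]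
    simp
  rw [← hec]
  refine ext_coord (M := M) (fun i => ?_) fun i => ?_
  · have h1 := hconst (fun s => M.xi i (f (M.act (e s) z))) (θ i) fun s => by
      have := (M.xi i).hasFDerivAt.comp_hasDerivAt s (hfcurve s)
      rwa [xi_lie hθ] at this
    rw [xi_act (he 1), h1, hone]
    simp [e]
  · have h1 := hconst (fun s => M.eta i (f (M.act (e s) z))) (-conj (θ i)) fun s => by
      have := (M.eta i).hasFDerivAt.comp_hasDerivAt s (hfcurve s)
      rwa [eta_lie hθ] at this
    rw [eta_act (he 1), h1, hone]
    simp [e, ← Complex.exp_conj, ← Complex.exp_neg]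

end BlockModel

namespace BlockModel

variable {ι V : Type} [Fintype ι] [NormedAddCommGroup V] [NormedSpace ℝ V] {M : BlockModel ι V}

theorem exists_xi_eq_one (i : ι) : ∃ v : V, M.xi i v = 1 := by
  classical
  cases hκ : M.kind i
  · refine ⟨M.single i (1, ((-1 / 2 : ℝ) : ℂ) * (Complex.I * 1)), ?_⟩
    rw [xi_single (by rw [hκ]; rfl)]
    simp
  · refine ⟨M.single i (1, 0), ?_⟩
    rw [xi_single (by rw [hκ]; exact ⟨rfl, rfl⟩)]
    simp
  · refine ⟨M.single i (1, 0), ?_⟩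
    rw [xi_single (by rw [hκ]; trivial)]
    simp

theorem dense_xi_ne_zero (i : ι) : Dense {z : V | M.xi i z ≠ 0} := by
  obtain ⟨v, hv⟩ := exists_xi_eq_one (M := M) i
  have hker : (LinearMap.ker (M.xi i : V →ₗ[ℝ] ℂ)) ≠ ⊤ := by
    intro h
    have : v ∈ LinearMap.ker (M.xi i : V →ₗ[ℝ] ℂ) := h ▸ Submodule.mem_top
    rw [LinearMap.mem_ker] at this
    exact one_ne_zero (hv.symm.trans this)
  have hintg : interior (LinearMap.ker (M.xi i : V →ₗ[ℝ] ℂ) : Set V) = ∅ := by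
    by_contra h
    exact hker (Submodule.eq_top_of_nonempty_interior' _ (nonempty_iff_ne_empty.2 h))
  exact interior_eq_empty_iff_dense_compl.1 hintg

theorem eq_of_eqOn_xi_ne_zero (i : ι) {X : Type*} [TopologicalSpace X] [T2Space X] {u v : V → X}
    (hu : Continuous u) (hv : Continuous v) (h : ∀ z, M.xi i z ≠ 0 → u z = v z) (z : V) :
    u z = v z :=
  congrFun (hu.ext_on (dense_xi_ne_zero (M := M) i) hv h) z

variable {P : Type} [NormedAddCommGroup P] [NormedSpace ℝ P]

/-- Smoothness of the integrand in the integral formulas for multipliers. -/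
theorem contDiffOn_kernel {B : Set P} (hB : IsOpen B) {f : P → V → V}
    (hf : ContDiffOn ℝ (⊤ : ℕ∞) (fun q : P × V => f q.1 q.2) (B ×ˢ univ)) (i : ι)
    (L : V →L[ℝ] V) (e : V) :
    ContDiffOn ℝ (⊤ : ℕ∞) (fun q : (P × V) × ℝ => M.xi i (fderiv ℝ (f q.1.1)
      (q.1.2 - (1 - q.2) • L q.1.2) e)) ((B ×ˢ univ) ×ˢ univ) := by
  have hopen : IsOpen (B ×ˢ (univ : Set V)) := hB.prod isOpen_univ
  have h1 := hf.fderiv_of_isOpen (m := (⊤ : ℕ∞)) hopen (by simp)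
  have h2 : ContDiff ℝ (⊤ : ℕ∞)
      fun q : (P × V) × ℝ => (q.1.1, q.1.2 - (1 - q.2) • L q.1.2) := by
    fun_prop
  have h3 := (h1.comp h2.contDiffOn (s := (B ×ˢ univ) ×ˢ univ)
    (fun q hq => ⟨hq.1.1, trivial⟩)).clm_apply (contDiffOn_const (c := ((0, e) : P × V)))
  refine ((M.xi i).contDiff.comp_contDiffOn h3).congr fun q hq => ?_
  have hmem : (q.1.1, q.1.2 - (1 - q.2) • L q.1.2) ∈ B ×ˢ (univ : Set V) := ⟨hq.1.1, trivial⟩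
  have hd := ((hf.differentiableOn (by simp)).differentiableAt (hopen.mem_nhds hmem)).hasFDerivAt
  have h4 := hd.comp _ (hasFDerivAt_prodMk_right q.1.1 (q.1.2 - (1 - q.2) • L q.1.2))
  have h5 : fderiv ℝ (f q.1.1) (q.1.2 - (1 - q.2) • L q.1.2) = _ := h4.fderiv
  simp [h5]

/-- The first coordinate of a hyperbolic block is mapped to zero where it vanishes. -/
theorem xi_map_eq_zero_of_hyperbolic [FiniteDimensional ℝ V] {f : V → V}
    (hf : Differentiable ℝ f)
    (hsymp : ∀ z u v, M.omega (fderiv ℝ f z u) (fderiv ℝ f z v) = M.omega u v)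
    (hmom : ∀ i z, M.mom i (f z) = M.mom i z) {i : ι} (hκ : M.kind i = .hyperbolic)
    {z : V} (hz : M.xi i z = 0) : M.xi i (f z) = 0 := by
  classical
  have had : (M.kind i).Admissible (0, M.eta i z) := by
    have := admissible_coord (M := M) z i
    rwa [hz] at this
  have hkey : ∀ t : ℝ, 0 < t →
      (t : ℂ) * M.xi i (f (z - (1 - t) • M.single i (0, M.eta i z))) = M.xi i (f z) := by
    intro t ht
    have htC : (t : ℂ) ≠ 0 := by exact_mod_cast ht.ne'
    have hc : ∀ j, (M.kind j).IsPositive ((Function.update 1 i (t : ℂ)⁻¹ : ι → ℂ) j) := by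
      intro j
      rcases eq_or_ne j i with rfl | hj
      · rw [hκ]
        refine ⟨⟨by simpa using htC, ?_⟩, fun _ => ?_⟩
        · rw [Function.update_self, ← Complex.ofReal_inv, Complex.ofReal_im]
        · rw [Function.update_self, ← Complex.ofReal_inv, Complex.ofReal_re]
          exact inv_pos.2 ht
      · have := (BlockKind.IsInfinitesimal.zero (κ := M.kind j)).exp
        simpa [hj] using this
    have hact : M.act (Function.update 1 i (t : ℂ)⁻¹) z =
        z - (1 - t) • M.single i (0, M.eta i z) := by
      refine ext_coord (M := M) (fun j => ?_) fun j => ?_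
      · rw [xi_act fun j => (hc j).1, map_sub, map_smul, xi_single had]
        rcases eq_or_ne j i with rfl | hj
        · simp [hz]
        · simp [hj]
      · rw [eta_act fun j => (hc j).1, map_sub, map_smul, eta_single had]
        rcases eq_or_ne j i with rfl | hj
        · simp
          ring
        · simp [hj]
    rw [← hact, map_act hf hsymp hmom hc, xi_act fun j => (hc j).1]
    simp [htC]
  have hcont : Continuous fun t : ℝ =>
      (t : ℂ) * M.xi i (f (z - (1 - t) • M.single i (0, M.eta i z))) := by
    have := hf.continuous
    fun_prop
  have hlim := (hcont.tendsto 0).mono_left (nhdsWithin_le_nhds (s := Ioi 0))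
  have hlim' : Tendsto (fun t : ℝ =>
      (t : ℂ) * M.xi i (f (z - (1 - t) • M.single i (0, M.eta i z)))) (𝓝[>] 0)
      (𝓝 (M.xi i (f z))) :=
    tendsto_const_nhds.congr' (by
      filter_upwards [self_mem_nhdsWithin] with t ht using (hkey t ht).symm)
  have := tendsto_nhds_unique hlim' hlim
  simpa using this

/-- The action of a momentum-preserving family of symplectic maps on the first coordinate of a
block is multiplication by a smooth function. -/
theorem exists_multiplier [FiniteDimensional ℝ V] [FiniteDimensional ℝ P] {B : Set P}
    (hB : IsOpen B) {f : P → V → V}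
    (hf : ContDiffOn ℝ (⊤ : ℕ∞) (fun q : P × V => f q.1 q.2) (B ×ˢ univ))
    (hsymp : ∀ p ∈ B, ∀ z u v, M.omega (fderiv ℝ (f p) z u) (fderiv ℝ (f p) z v) = M.omega u v)
    (hmom : ∀ p ∈ B, ∀ i z, M.mom i (f p z) = M.mom i z) (i : ι) :
    ∃ b : P × V → ℂ, ContDiffOn ℝ (⊤ : ℕ∞) b (B ×ˢ univ) ∧
      ∀ p ∈ B, ∀ z, M.xi i (f p z) = b (p, z) * M.xi i z := by
  classical
  have hfp : ∀ p ∈ B, ContDiff ℝ (⊤ : ℕ∞) (f p) := fun p hp =>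
    contDiffOn_univ.1 (hf.comp (contDiff_prodMk_right p).contDiffOn fun z _ => ⟨hp, trivial⟩)
  have hd : ∀ p ∈ B, Differentiable ℝ (f p) := fun p hp => (hfp p hp).differentiable (by simp)
  have hopen : IsOpen (B ×ˢ (univ : Set V)) := hB.prod isOpen_univ
  have hcurve : ∀ p ∈ B, ∀ (z w : V) (t : ℝ),
      HasDerivAt (fun t : ℝ => M.xi i (f p (z - (1 - t) • w)))
        (M.xi i (fderiv ℝ (f p) (z - (1 - t) • w) w)) t := by
    intro p hp z w t
    have h1 : HasDerivAt (fun t : ℝ => z - (1 - t) • w) w t := by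
      have := (((hasDerivAt_id t).const_sub 1).smul_const w).const_sub z
      simpa using this
    exact (M.xi i).hasFDerivAt.comp_hasDerivAt t
      ((hd p hp _).hasFDerivAt.comp_hasDerivAt t h1)
  have hcontK : ∀ p ∈ B, ∀ (z w e : V), Continuous fun t : ℝ =>
      M.xi i (fderiv ℝ (f p) (z - (1 - t) • w) e) := by
    intro p hp z w e
    have := (hfp p hp).continuous_fderiv (by simp)
    fun_prop
  cases hκ : M.kind i
  · have h1 : (M.kind i).Admissible (1, ((-1 / 2 : ℝ) : ℂ) * (Complex.I * 1)) := by
      rw [hκ]; rfl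
    have h2 : (M.kind i).Admissible
        (Complex.I, ((-1 / 2 : ℝ) : ℂ) * (Complex.I * Complex.I)) := by
      rw [hκ]; rfl
    set e₁ : V := M.single i (1, ((-1 / 2 : ℝ) : ℂ) * (Complex.I * 1))
    set e₂ : V := M.single i (Complex.I, ((-1 / 2 : ℝ) : ℂ) * (Complex.I * Complex.I))
    let L : V →L[ℝ] V := (Complex.reCLM.comp (M.xi i)).smulRight e₁ +
      (Complex.imCLM.comp (M.xi i)).smulRight e₂
    have hL : ∀ z, L z = (M.xi i z).re • e₁ + (M.xi i z).im • e₂ := fun z => rfl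
    have hθ : ∀ j, (M.kind j).IsInfinitesimal ((Pi.single i Complex.I : ι → ℂ) j) := by
      intro j
      rcases eq_or_ne j i with rfl | hj
      · rw [hκ]
        simp [BlockKind.IsInfinitesimal]
      · simpa [hj] using BlockKind.IsInfinitesimal.zero
    have hlie : ∀ (z : V) (t : ℝ), M.lie (Pi.single i Complex.I) (z - (1 - t) • L z) =
        t • (-(M.xi i z).im • e₁ + (M.xi i z).re • e₂) := by
      intro z t
      have hη : M.eta i z = ((-1 / 2 : ℝ) : ℂ) * (Complex.I * M.xi i z) := by
        have := admissible_coord (M := M) z i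
        rw [hκ] at this
        exact this
      have hre := Complex.re_add_im (M.xi i z)
      refine ext_coord (M := M) (fun j => ?_) fun j => ?_
      · rw [xi_lie hθ]
        rcases eq_or_ne j i with rfl | hj
        · simp only [hL, map_sub, map_add, map_smul, e₁, e₂, xi_single h1, xi_single h2,
            Pi.single_eq_same, Complex.real_smul]
          push_cast
          nth_rewrite 1 [← hre]
          linear_combination (t * (M.xi j z).im : ℂ) * Complex.I_mul_I
        · simp only [hL, map_sub, map_add, map_smul, e₁, e₂, xi_single h1, xi_single h2,
            Pi.single_eq_of_ne hj]
          simp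
      · rw [eta_lie hθ]
        rcases eq_or_ne j i with rfl | hj
        · simp only [hL, map_sub, map_add, map_smul, e₁, e₂, eta_single h1, eta_single h2,
            Pi.single_eq_same, Complex.real_smul, hη, Complex.conj_I]
          push_cast
          nth_rewrite 1 [← hre]
          linear_combination (-(1 / 2) * t * Complex.I * (M.xi j z).im : ℂ) * Complex.I_mul_I
        · simp only [hL, map_sub, map_add, map_smul, e₁, e₂, eta_single h1, eta_single h2,
            Pi.single_eq_of_ne hj]
          simp
    refine ⟨fun q => ∫ t in (0 : ℝ)..1, (t : ℂ) *
      (M.xi i (fderiv ℝ (f q.1) (q.2 - (1 - t) • L q.2) e₁) -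
        Complex.I * M.xi i (fderiv ℝ (f q.1) (q.2 - (1 - t) • L q.2) e₂)), ?_, ?_⟩
    · refine contDiffOn_intervalIntegral hopen (F := fun q : (P × V) × ℝ => (q.2 : ℂ) *
        (M.xi i (fderiv ℝ (f q.1.1) (q.1.2 - (1 - q.2) • L q.1.2) e₁) -
        Complex.I * M.xi i (fderiv ℝ (f q.1.1) (q.1.2 - (1 - q.2) • L q.1.2) e₂))) ?_
      exact (Complex.ofRealCLM.contDiff.comp contDiff_snd).contDiffOn.mul
        ((contDiffOn_kernel hB hf i L e₁).sub
          (contDiffOn_const.mul (contDiffOn_kernel hB hf i L e₂)))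
    · intro p hp z
      have hder : ∀ t : ℝ, HasDerivAt
          (fun t : ℝ => (t : ℂ) * M.xi i (f p (z - (1 - t) • L z)))
          (((t : ℂ) * (M.xi i (fderiv ℝ (f p) (z - (1 - t) • L z) e₁) -
            Complex.I * M.xi i (fderiv ℝ (f p) (z - (1 - t) • L z) e₂))) * M.xi i z) t := by
        intro t
        refine ((Complex.ofRealCLM.hasDerivAt (x := t)).mul
          (hcurve p hp z (L z) t)).congr_deriv ?_
        have h3 := fderiv_lie (hd p hp (z - (1 - t) • L z)) (hsymp p hp _) (hmom p hp) hθ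
        rw [hlie] at h3
        have h4 := congrArg (M.xi i) h3
        rw [xi_lie hθ] at h4
        simp only [map_smul, map_add, Pi.single_eq_same, Complex.real_smul] at h4
        have hre := Complex.re_add_im (M.xi i z)
        have h5 : ∀ A : V →L[ℝ] V, M.xi i (A (L z)) =
            (M.xi i z).re * M.xi i (A e₁) + (M.xi i z).im * M.xi i (A e₂) := fun A => by
          simp only [hL, map_add, map_smul, Complex.real_smul]
        have h6 := h5 (fderiv ℝ (f p) (z - (1 - t) • L z))
        conv_rhs => rw [← hre]
        simp only [Complex.ofRealCLM_apply, Complex.ofReal_one, one_mul]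
        push_cast at h4 ⊢
        linear_combination (t : ℂ) * h6 + Complex.I * h4 + (M.xi i (f p (z - (1 - t) • L z)) +
          t * (M.xi i z).im * M.xi i (fderiv ℝ (f p) (z - (1 - t) • L z) e₂)) * Complex.I_mul_I
      have hintg := intervalIntegral.integral_eq_sub_of_hasDerivAt (a := 0) (b := 1)
        (fun t _ => hder t) (Continuous.intervalIntegrable (by
          have := hcontK p hp z (L z) e₁
          have := hcontK p hp z (L z) e₂
          fun_prop) _ _)
      rw [intervalIntegral.integral_mul_const] at hintg
      rw [hintg]
      simp
  · have h1 : (M.kind i).Admissible (1, 0) := by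
      rw [hκ]; exact ⟨rfl, rfl⟩
    set e : V := M.single i (1, 0)
    let L : V →L[ℝ] V := (Complex.reCLM.comp (M.xi i)).smulRight e
    have hL : ∀ z, L z = (M.xi i z).re • e := fun z => rfl
    have hreal : ∀ z, ((M.xi i z).re : ℂ) = M.xi i z := fun z => by
      have := admissible_coord (M := M) z i
      rw [hκ] at this
      exact Complex.ext rfl (by simpa using this.1.symm)
    refine ⟨fun q => ∫ t in (0 : ℝ)..1, M.xi i (fderiv ℝ (f q.1) (q.2 - (1 - t) • L q.2) e),
      contDiffOn_intervalIntegral hopen (contDiffOn_kernel hB hf i L e), ?_⟩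
    intro p hp z
    have hder : ∀ t : ℝ, HasDerivAt (fun t : ℝ => M.xi i (f p (z - (1 - t) • L z)))
        (M.xi i (fderiv ℝ (f p) (z - (1 - t) • L z) e) * M.xi i z) t := by
      intro t
      refine (hcurve p hp z (L z) t).congr_deriv ?_
      nth_rewrite 2 [hL]
      rw [map_smul, map_smul, Complex.real_smul, hreal, mul_comm]
    have hintg := intervalIntegral.integral_eq_sub_of_hasDerivAt (a := 0) (b := 1)
      (fun t _ => hder t) (Continuous.intervalIntegrable (by
        have := hcontK p hp z (L z) e
        fun_prop) _ _)
    rw [intervalIntegral.integral_mul_const] at hintg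
    have hzero : M.xi i (f p (z - L z)) = 0 := by
      refine xi_map_eq_zero_of_hyperbolic (hd p hp) (hsymp p hp) (hmom p hp) hκ ?_
      rw [hL, map_sub, map_smul, xi_single h1, Complex.real_smul, hreal]
      simp
    rw [hintg]
    simp [hzero]
  · have had : ∀ w, (M.kind i).Admissible w := fun w => by rw [hκ]; trivial
    have hins : ContDiff ℝ (⊤ : ℕ∞) fun z : V =>
        z + M.single i (1 - M.xi i z, conj (M.xi i z) * M.eta i z - M.eta i z) := by
      have h1 : ContDiff ℝ (⊤ : ℕ∞) fun z : V => conj (M.xi i z) :=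
        (Complex.conjCLE : ℂ →L[ℝ] ℂ).contDiff.comp (M.xi i).contDiff
      have h2 : ContDiff ℝ (⊤ : ℕ∞) fun w : ℂ × ℂ => M.single i w :=
        M.ofC.contDiff.comp (ContinuousLinearMap.single ℝ (fun _ : ι => ℂ × ℂ) i).contDiff
      exact contDiff_id.add (h2.comp ((contDiff_const.sub (M.xi i).contDiff).prodMk
        ((h1.mul (M.eta i).contDiff).sub (M.eta i).contDiff)))
    refine ⟨fun q => M.xi i (f q.1 (q.2 +
      M.single i (1 - M.xi i q.2, conj (M.xi i q.2) * M.eta i q.2 - M.eta i q.2))), ?_, ?_⟩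
    · exact (M.xi i).contDiff.comp_contDiffOn (hf.comp
        (contDiff_fst.prodMk (hins.comp contDiff_snd)).contDiffOn fun q hq => ⟨hq.1, trivial⟩)
    · intro p hp
      have hc1 := (hd p hp).continuous
      have hc2 := hins.continuous
      refine eq_of_eqOn_xi_ne_zero (M := M) i (by fun_prop)
        (((M.xi i).continuous.comp (hc1.comp hc2)).mul (M.xi i).continuous) fun z hz => ?_
      have hc : ∀ j, (M.kind j).IsPositive ((Function.update 1 i (M.xi i z) : ι → ℂ) j) := by
        intro j
        rcases eq_or_ne j i with rfl | hj
        · rw [hκ]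
          exact ⟨by simpa [BlockKind.IsMultiplier] using hz, nofun⟩
        · have := (BlockKind.IsInfinitesimal.zero (κ := M.kind j)).exp
          simpa [hj] using this
      have hact : M.act (Function.update 1 i (M.xi i z)) (z +
          M.single i (1 - M.xi i z, conj (M.xi i z) * M.eta i z - M.eta i z)) = z := by
        refine ext_coord (M := M) (fun j => ?_) fun j => ?_
        · rw [xi_act fun j => (hc j).1, map_add, xi_single (had _)]
          rcases eq_or_ne j i with rfl | hj
          · simp
          · simp [hj]
        · rw [eta_act fun j => (hc j).1, map_add, eta_single (had _)]
          rcases eq_or_ne j i with rfl | hj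
          · have : conj (M.xi j z) ≠ 0 := (map_ne_zero _).2 hz
            simp [this]
          · simp [hj]
      conv_lhs => rw [← hact, map_act (hd p hp) (hsymp p hp) (hmom p hp) hc,
        xi_act fun j => (hc j).1]
      simp [mul_comm]

end BlockModel

section

variable {ι V P : Type} [Fintype ι] [NormedAddCommGroup V] [NormedSpace ℝ V]
  [NormedAddCommGroup P] [NormedSpace ℝ P]

/-- A smooth family of symplectic actions preserving the momenta, together with the cocycle by
which it multiplies the first block coordinates. -/
structure IsSystemAction {G : Type*} [Group G] [TopologicalSpace G] (M : BlockModel ι V)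
    (B : Set P) (ρ : G → P → V → V) (b : G → ι → P × V → ℂ) : Prop where
  isOpen : IsOpen B
  convex : Convex ℝ B
  zero_mem : 0 ∈ B
  continuous : Continuous fun x : G × P × V => ρ x.1 x.2.1 x.2.2
  contDiffOn : ∀ g, ContDiffOn ℝ (⊤ : ℕ∞) (fun q : P × V => ρ g q.1 q.2) (B ×ˢ univ)
  one : ∀ p ∈ B, ρ 1 p = id
  mul : ∀ g₁ g₂, ∀ p ∈ B, ρ (g₁ * g₂) p = ρ g₁ p ∘ ρ g₂ p
  omega_fderiv : ∀ g, ∀ p ∈ B, ∀ z u v,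
    M.omega (fderiv ℝ (ρ g p) z u) (fderiv ℝ (ρ g p) z v) = M.omega u v
  mom_map : ∀ g, ∀ p ∈ B, ∀ i z, M.mom i (ρ g p z) = M.mom i z
  contDiffOn_cocycle : ∀ g i, ContDiffOn ℝ (⊤ : ℕ∞) (b g i) (B ×ˢ univ)
  xi_map : ∀ g, ∀ p ∈ B, ∀ z i, M.xi i (ρ g p z) = b g i (p, z) * M.xi i z

namespace IsSystemAction

open BlockModel

variable {G : Type*} [Group G] [TopologicalSpace G] {M : BlockModel ι V}
  {B : Set P} {ρ : G → P → V → V} {b : G → ι → P × V → ℂ}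

theorem contDiff_map (h : IsSystemAction M B ρ b) (g : G) {p : P} (hp : p ∈ B) :
    ContDiff ℝ (⊤ : ℕ∞) (ρ g p) :=
  contDiffOn_univ.1 ((h.contDiffOn g).comp (contDiff_prodMk_right p).contDiffOn
    fun _ _ => ⟨hp, trivial⟩)

theorem contDiff_cocycle (h : IsSystemAction M B ρ b) (g : G) (i : ι) {p : P} (hp : p ∈ B) :
    ContDiff ℝ (⊤ : ℕ∞) fun z => b g i (p, z) :=
  contDiffOn_univ.1 ((h.contDiffOn_cocycle g i).comp (contDiff_prodMk_right p).contDiffOn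
    fun _ _ => ⟨hp, trivial⟩)

theorem continuous_map (h : IsSystemAction M B ρ b) (g : G) {p : P} (hp : p ∈ B) :
    Continuous (ρ g p) := (h.contDiff_map g hp).continuous

theorem continuous_cocycle (h : IsSystemAction M B ρ b) (g : G) (i : ι) {p : P} (hp : p ∈ B) :
    Continuous fun z => b g i (p, z) := (h.contDiff_cocycle g i hp).continuous

theorem conj_mul_eta_map (h : IsSystemAction M B ρ b) (g : G) {p : P} (hp : p ∈ B) (z : V)
    (i : ι) : conj (b g i (p, z)) * M.eta i (ρ g p z) = M.eta i z := by
  have h1 := h.continuous_map g hp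
  have h2 := h.continuous_cocycle g i hp
  refine eq_of_eqOn_xi_ne_zero (M := M) i (u := fun z => conj (b g i (p, z)) * M.eta i (ρ g p z))
    ((Complex.continuous_conj.comp h2).mul ((M.eta i).continuous.comp h1)) (M.eta i).continuous
    (fun z hz => ?_) z
  have h3 := h.mom_map g p hp i z
  rw [mom, mom, h.xi_map g p hp, map_mul] at h3
  refine mul_left_cancel₀ ((map_ne_zero (starRingEnd ℂ)).2 hz) ?_
  linear_combination h3

theorem cocycle_one (h : IsSystemAction M B ρ b) {p : P} (hp : p ∈ B) (z : V) (i : ι) :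
    b 1 i (p, z) = 1 := by
  refine eq_of_eqOn_xi_ne_zero (M := M) i (h.continuous_cocycle 1 i hp) continuous_const
    (fun z hz => ?_) z
  have h1 := h.xi_map 1 p hp z i
  rw [h.one p hp, id] at h1
  exact mul_right_cancel₀ hz (by rw [← h1, one_mul])

theorem cocycle_mul (h : IsSystemAction M B ρ b) (g g' : G) {p : P} (hp : p ∈ B) (z : V)
    (i : ι) : b (g * g') i (p, z) = b g i (p, ρ g' p z) * b g' i (p, z) := by
  have h1 := h.continuous_cocycle g i hp
  refine eq_of_eqOn_xi_ne_zero (M := M) i (h.continuous_cocycle _ i hp)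
    ((h1.comp (h.continuous_map g' hp)).mul (h.continuous_cocycle g' i hp)) (fun z hz => ?_) z
  have h2 := h.xi_map (g * g') p hp z i
  rw [h.mul g g' p hp, Function.comp_apply, h.xi_map g p hp, h.xi_map g' p hp] at h2
  exact mul_right_cancel₀ hz (h2.symm.trans (mul_assoc _ _ _).symm)

theorem cocycle_ne_zero (h : IsSystemAction M B ρ b) (g : G) {p : P} (hp : p ∈ B) (z : V)
    (i : ι) : b g i (p, z) ≠ 0 := by
  have h1 := h.cocycle_mul g⁻¹ g hp z i
  rw [inv_mul_cancel, h.cocycle_one hp] at h1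
  exact right_ne_zero_of_mul (h1 ▸ one_ne_zero)

theorem isMultiplier (h : IsSystemAction M B ρ b) (g : G) {p : P} (hp : p ∈ B) (z : V)
    (i : ι) : (M.kind i).IsMultiplier (b g i (p, z)) := by
  have hc := h.continuous_cocycle g i hp
  cases hκ : M.kind i
  · have had : ∀ z, M.eta i z = ((-1 / 2 : ℝ) : ℂ) * (Complex.I * M.xi i z) := fun z => by
      have := admissible_coord (M := M) z i
      rw [hκ] at this
      exact this
    refine eq_of_eqOn_xi_ne_zero (M := M) i (u := fun z => conj (b g i (p, z)) * b g i (p, z))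
      ((Complex.continuous_conj.comp hc).mul hc) continuous_const (fun z hz => ?_) z
    have h1 := h.conj_mul_eta_map g hp z i
    rw [had, had, h.xi_map g p hp] at h1
    have h2 : ((-1 / 2 : ℝ) : ℂ) * (Complex.I * M.xi i z) ≠ 0 :=
      mul_ne_zero (by norm_num) (mul_ne_zero Complex.I_ne_zero hz)
    refine mul_right_cancel₀ h2 ?_
    linear_combination h1
  · refine ⟨h.cocycle_ne_zero g hp z i, ?_⟩
    refine eq_of_eqOn_xi_ne_zero (M := M) i (u := fun z => (b g i (p, z)).im)
      (Complex.continuous_im.comp hc) continuous_const (fun z hz => ?_) z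
    have had : ∀ z, (M.xi i z).im = 0 := fun z => by
      have := admissible_coord (M := M) z i
      rw [hκ] at this
      exact this.1
    have h1 := had (ρ g p z)
    rw [h.xi_map g p hp, Complex.mul_im, had z, mul_zero, zero_add] at h1
    exact (mul_eq_zero.1 h1).resolve_right fun h2 => hz (Complex.ext h2 (had z))
  · exact h.cocycle_ne_zero g hp z i

theorem eta_map (h : IsSystemAction M B ρ b) (g : G) {p : P} (hp : p ∈ B) (z : V)
    (i : ι) : M.eta i (ρ g p z) = (conj (b g i (p, z)))⁻¹ * M.eta i z := by
  rw [← h.conj_mul_eta_map g hp z i, inv_mul_cancel_left₀ (h.isMultiplier g hp z i).conj_ne_zero]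

theorem map_eq_act (h : IsSystemAction M B ρ b) (g : G) {p : P} (hp : p ∈ B) (z : V) :
    ρ g p z = M.act (fun i => b g i (p, z)) z :=
  ext_coord (M := M)
    (fun i => by rw [xi_act fun i => h.isMultiplier g hp z i, h.xi_map g p hp])
    fun i => by rw [eta_act fun i => h.isMultiplier g hp z i, h.eta_map g hp]

theorem map_zero (h : IsSystemAction M B ρ b) (g : G) {p : P} (hp : p ∈ B) : ρ g p 0 = 0 :=
  ext_coord (M := M) (fun i => by simp [h.xi_map g p hp]) fun i => by simp [h.eta_map g hp]

theorem cocycle_act [FiniteDimensional ℝ V] (h : IsSystemAction M B ρ b) (g : G) {p : P}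
    (hp : p ∈ B) {c : ι → ℂ} (hc : ∀ i, (M.kind i).IsPositive (c i)) (z : V) (i : ι) :
    b g i (p, M.act c z) = b g i (p, z) := by
  have hact : Continuous (M.act c) := by
    unfold act
    fun_prop
  refine eq_of_eqOn_xi_ne_zero (M := M) i ((h.continuous_cocycle g i hp).comp hact)
    (h.continuous_cocycle g i hp) (fun z hz => ?_) z
  have h1 := congrArg (M.xi i) (map_act (M := M) ((h.contDiff_map g hp).differentiable (by simp))
    (h.omega_fderiv g p hp) (h.mom_map g p hp) hc z)
  rw [h.xi_map g p hp, xi_act fun i => (hc i).1, xi_act fun i => (hc i).1, h.xi_map g p hp] at h1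
  refine mul_right_cancel₀ (mul_ne_zero (hc i).1.ne_zero hz) ?_
  simp only [Function.comp_apply]
  linear_combination h1

theorem hyperbolic_re_pos_iff (h : IsSystemAction M B ρ b) (g : G) {p : P} (hp : p ∈ B) (z : V)
    {i : ι} (hκ : M.kind i = .hyperbolic) :
    0 < (b g i (p, z)).re ↔ 0 < (b g i (0, 0)).re := by
  have hconn : IsPreconnected (B ×ˢ (univ : Set V)) :=
    (h.convex.prod convex_univ).isPreconnected
  have hc : ContinuousOn (fun q => (b g i q).re) (B ×ˢ (univ : Set V)) :=
    Complex.continuous_re.comp_continuousOn (h.contDiffOn_cocycle g i).continuousOn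
  have hne : ∀ q ∈ B ×ˢ (univ : Set V), (b g i q).re ≠ 0 := by
    rintro ⟨p, z⟩ ⟨hp, -⟩ h0
    have h1 := h.isMultiplier g hp z i
    rw [hκ] at h1
    exact h1.1 (Complex.ext h0 h1.2)
  have himg := hconn.image _ hc
  have key : ∀ q ∈ B ×ˢ (univ : Set V), ∀ q' ∈ B ×ˢ (univ : Set V),
      0 < (b g i q).re → 0 < (b g i q').re := by
    intro q hq q' hq' hpos
    by_contra hneg
    obtain ⟨x, hx, hx0⟩ := himg.Icc_subset (mem_image_of_mem _ hq') (mem_image_of_mem _ hq)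
      ⟨not_lt.1 hneg, hpos.le⟩
    exact hne x hx hx0
  exact ⟨key _ ⟨hp, trivial⟩ _ ⟨h.zero_mem, trivial⟩, key _ ⟨h.zero_mem, trivial⟩ _ ⟨hp, trivial⟩⟩

/-- The elements of the group acting by multipliers in the identity component. -/
def IsPositiveAt (M : BlockModel ι V) (b : G → ι → P × V → ℂ) (g : G) : Prop :=
  ∀ i, (M.kind i).IsPositive (b g i (0, 0))

theorem isPositive_cocycle (h : IsSystemAction M B ρ b) {g : G} (hg : IsPositiveAt M b g) {p : P}
    (hp : p ∈ B) (z : V) (i : ι) : (M.kind i).IsPositive (b g i (p, z)) :=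
  ⟨h.isMultiplier g hp z i, fun hκ => (h.hyperbolic_re_pos_iff g hp z hκ).2 ((hg i).2 hκ)⟩

theorem isPositiveAt_mul_self (h : IsSystemAction M B ρ b) (g : G) :
    IsPositiveAt M b (g * g) := fun i => by
  have h1 := h.isMultiplier g h.zero_mem 0 i
  rw [h.cocycle_mul g g h.zero_mem, h.map_zero g h.zero_mem]
  refine ⟨h1.mul h1, fun hκ => ?_⟩
  rw [hκ] at h1
  rw [Complex.mul_re, h1.2, mul_zero, sub_zero]
  exact mul_self_pos.2 fun h0 => h1.1 (Complex.ext h0 h1.2)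

variable [FiniteDimensional ℝ V]

theorem cocycle_map_of_isPositiveAt (h : IsSystemAction M B ρ b) (g : G) {g' : G}
    (hg : IsPositiveAt M b g') {p : P} (hp : p ∈ B) (z : V) (i : ι) :
    b g i (p, ρ g' p z) = b g i (p, z) := by
  rw [h.map_eq_act g' hp, h.cocycle_act g hp (h.isPositive_cocycle hg hp z)]

theorem cocycle_mul_of_isPositiveAt (h : IsSystemAction M B ρ b) (g : G) {g' : G}
    (hg : IsPositiveAt M b g') {p : P} (hp : p ∈ B) (z : V) (i : ι) :
    b (g * g') i (p, z) = b g i (p, z) * b g' i (p, z) := by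
  rw [h.cocycle_mul g g' hp, h.cocycle_map_of_isPositiveAt g hg hp]

theorem cocycle_pow_of_isPositiveAt (h : IsSystemAction M B ρ b) {g : G}
    (hg : IsPositiveAt M b g) (n : ℕ) {p : P} (hp : p ∈ B) (z : V) (i : ι) :
    b (g ^ n) i (p, z) = b g i (p, z) ^ n := by
  induction n with
  | zero => simpa using h.cocycle_one hp z i
  | succ n ih => rw [pow_succ, pow_succ, h.cocycle_mul_of_isPositiveAt _ hg hp, ih]

theorem cocycle_inv_of_isPositiveAt (h : IsSystemAction M B ρ b) {g : G}
    (hg : IsPositiveAt M b g) {p : P} (hp : p ∈ B) (z : V) (i : ι) :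
    b g⁻¹ i (p, z) = (b g i (p, z))⁻¹ := by
  have h1 := h.cocycle_mul_of_isPositiveAt g⁻¹ hg hp z i
  rw [inv_mul_cancel, h.cocycle_one hp] at h1
  exact eq_inv_of_mul_eq_one_left h1.symm

theorem isPositiveAt_inv (h : IsSystemAction M B ρ b) {g : G}
    (hg : IsPositiveAt M b g) : IsPositiveAt M b g⁻¹ := fun i => by
  rw [h.cocycle_inv_of_isPositiveAt hg h.zero_mem]
  refine ⟨(hg i).1.inv, fun hκ => ?_⟩
  rw [Complex.inv_re]
  exact div_pos ((hg i).2 hκ) (Complex.normSq_pos.2 (hg i).1.ne_zero)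

variable [CompactSpace G]

theorem norm_cocycle_le_one (h : IsSystemAction M B ρ b) {g : G}
    (hg : IsPositiveAt M b g) {p : P} (hp : p ∈ B) {z : V} {i : ι} (hz : M.xi i z ≠ 0) :
    ‖b g i (p, z)‖ ≤ 1 := by
  have hcont : Continuous fun g => M.xi i (ρ g p z) := by
    have := h.continuous
    exact (M.xi i).continuous.comp (this.comp (by fun_prop : Continuous fun g : G => (g, p, z)))
  obtain ⟨C, hC⟩ := isCompact_univ.exists_bound_of_continuousOn hcont.continuousOn
  by_contra hlt
  obtain ⟨n, hn⟩ := pow_unbounded_of_one_lt (C / ‖M.xi i z‖) (not_le.1 hlt)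
  have h1 := hC (g ^ n) trivial
  rw [h.xi_map _ p hp, h.cocycle_pow_of_isPositiveAt hg n hp, norm_mul, norm_pow,
    ← le_div_iff₀ (norm_pos_iff.2 hz)] at h1
  exact absurd hn (not_lt.2 h1)

theorem norm_cocycle_eq_one (h : IsSystemAction M B ρ b) {g : G}
    (hg : IsPositiveAt M b g) {p : P} (hp : p ∈ B) {z : V} {i : ι} (hz : M.xi i z ≠ 0) :
    ‖b g i (p, z)‖ = 1 := by
  refine le_antisymm (h.norm_cocycle_le_one hg hp hz) ?_
  have h1 := h.norm_cocycle_le_one (h.isPositiveAt_inv hg) hp hz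
  rw [h.cocycle_inv_of_isPositiveAt hg hp, norm_inv] at h1
  exact (inv_le_one₀ (norm_pos_iff.2 (h.cocycle_ne_zero g hp z i))).1 h1

/-- Along rays, the multiplier of an element of the identity component is locally constant. -/
theorem eventually_cocycle_smul_eq (h : IsSystemAction M B ρ b) {g : G}
    (hg : IsPositiveAt M b g) {p : P} (hp : p ∈ B) {z : V} {i : ι} (hz : M.xi i z ≠ 0) {t : ℝ}
    (ht : t ∈ Ioc (0 : ℝ) 1) :
    ∀ᶠ s in 𝓝[≤] t, b g i (s • p, s • z) = b g i (t • p, t • z) := by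
  have hmem : ∀ s ∈ Ioc (0 : ℝ) 1, s • p ∈ B := fun s hs =>
    h.convex.smul_mem_of_zero_mem h.zero_mem hp ⟨hs.1.le, hs.2⟩
  have hne : ∀ s ∈ Ioc (0 : ℝ) 1, (s : ℂ) * M.xi i z ≠ 0 := fun s hs =>
    mul_ne_zero (by exact_mod_cast hs.1.ne') hz
  have hxi : ∀ s ∈ Ioc (0 : ℝ) 1, M.xi i (s • z) ≠ 0 := fun s hs => by
    rw [map_smul, Complex.real_smul]
    exact hne s hs
  let F : ℝ → G → ℂ := fun s g => M.xi i (ρ g (s • p) (s • z)) / (s * M.xi i z)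
  have hF : ∀ s ∈ Ioc (0 : ℝ) 1, ∀ g, F s g = b g i (s • p, s • z) := fun s hs g => by
    simp only [F]
    rw [h.xi_map g _ (hmem s hs), map_smul, Complex.real_smul, mul_div_cancel_right₀ _ (hne s hs)]
  have hclose : ∀ᶠ s in 𝓝 t, ∀ g ∈ (univ : Set G), ‖F s g - F t g‖ ≤ 1 / 2 := by
    refine isCompact_univ.eventually_forall_of_forall_eventually fun g _ => ?_
    have hnum : Continuous fun x : ℝ × G => M.xi i (ρ x.2 (x.1 • p) (x.1 • z)) :=
      (M.xi i).continuous.comp (h.continuous.comp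
        (by fun_prop : Continuous fun x : ℝ × G => (x.2, x.1 • p, x.1 • z)))
    have hcF : ContinuousAt (fun x : ℝ × G => F x.1 x.2) (t, g) :=
      hnum.continuousAt.div (by fun_prop) (hne t ht)
    have hcF' : ContinuousAt (fun x : ℝ × G => F t x.2) (t, g) := by
      have : Continuous fun x : ℝ × G => M.xi i (ρ x.2 (t • p) (t • z)) :=
        hnum.comp (by fun_prop : Continuous fun x : ℝ × G => (t, x.2))
      exact (this.div_const _).continuousAt
    have hlim : Tendsto (fun x : ℝ × G => ‖F x.1 x.2 - F t x.2‖) (𝓝 (t, g)) (𝓝 0) := by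
      simpa using ((hcF.sub hcF').norm).tendsto
    exact (hlim.eventually_lt_const (by norm_num)).mono fun _ hx => le_of_lt hx
  filter_upwards [nhdsWithin_le_nhds hclose, nhdsWithin_le_nhds (lt_mem_nhds ht.1),
    self_mem_nhdsWithin] with s hs hs0 hst
  have hs1 : s ∈ Ioc (0 : ℝ) 1 := ⟨hs0, le_trans hst ht.2⟩
  have hn := h.norm_cocycle_eq_one hg (hmem t ht) (hxi t ht)
  have hn0 := h.cocycle_ne_zero g (hmem t ht) (t • z) i
  have hw : b g i (s • p, s • z) / b g i (t • p, t • z) = 1 := by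
    refine eq_one_of_norm_pow_sub_one_le fun n => ?_
    have h1 := hs (g ^ n) trivial
    rw [hF s hs1, hF t ht, h.cocycle_pow_of_isPositiveAt hg n (hmem s hs1),
      h.cocycle_pow_of_isPositiveAt hg n (hmem t ht)] at h1
    rw [div_pow, div_sub_one (pow_ne_zero n hn0), norm_div, norm_pow, hn, one_pow, div_one]
    exact h1
  exact (div_eq_one_iff_eq hn0).1 hw

/-- The multipliers of elements of the identity component are constant. -/
theorem cocycle_eq_of_isPositiveAt (h : IsSystemAction M B ρ b) {g : G}
    (hg : IsPositiveAt M b g) {p : P} (hp : p ∈ B) (z : V) (i : ι) :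
    b g i (p, z) = b g i (0, 0) := by
  refine eq_of_eqOn_xi_ne_zero (M := M) i (h.continuous_cocycle g i hp) continuous_const
    (fun z hz => ?_) z
  have hcont : ContinuousOn (fun s : ℝ => b g i ((1 - s) • p, (1 - s) • z)) (Icc 0 1) := by
    refine (h.contDiffOn_cocycle g i).continuousOn.comp (t := B ×ˢ univ)
      (f := fun s : ℝ => ((1 - s) • p, (1 - s) • z)) (by fun_prop) fun s hs => ⟨?_, trivial⟩
    exact h.convex.smul_mem_of_zero_mem h.zero_mem hp ⟨by linarith [hs.2], by linarith [hs.1]⟩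
  have hder : ∀ s ∈ Ico (0 : ℝ) 1,
      HasDerivWithinAt (fun s : ℝ => b g i ((1 - s) • p, (1 - s) • z)) 0 (Ici s) s := by
    intro s hs
    refine (hasDerivWithinAt_const s (Ici s)
      (b g i ((1 - s) • p, (1 - s) • z))).congr_of_eventuallyEq ?_ rfl
    have h1 := h.eventually_cocycle_smul_eq hg hp hz (t := 1 - s)
      ⟨by linarith [hs.2], by linarith [hs.1]⟩
    have h2 : Tendsto (fun s : ℝ => 1 - s) (𝓝[≥] s) (𝓝[≤] (1 - s)) :=
      tendsto_nhdsWithin_of_tendsto_nhds_of_eventually_within _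
        ((by fun_prop : Continuous fun s : ℝ => 1 - s).continuousAt.mono_left nhdsWithin_le_nhds)
        (by filter_upwards [self_mem_nhdsWithin] with x hx using
          sub_le_sub_left (mem_Ici.1 hx) (1 : ℝ))
    exact h2.eventually h1
  have h1 := constant_of_has_deriv_right_zero hcont hder 1 ⟨zero_le_one, le_rfl⟩
  simpa using h1.symm

/-- The linear parts at the origin do not depend on the parameter. -/
theorem cocycle_zero (h : IsSystemAction M B ρ b) (g : G) {p : P} (hp : p ∈ B) (i : ι) :
    b g i (p, 0) = b g i (0, 0) := by
  have hc : ContinuousOn (fun p => b g i (p, (0 : V))) B :=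
    (h.contDiffOn_cocycle g i).continuousOn.comp (by fun_prop) fun p hp => ⟨hp, trivial⟩
  refine h.convex.isPreconnected.eq_of_sq_eq hc (continuousOn_const (c := b g i (0, 0)))
    (fun p hp => ?_) (fun _ => h.cocycle_ne_zero g h.zero_mem 0 i) h.zero_mem rfl hp
  have h1 := h.cocycle_mul g g hp 0 i
  have h2 := h.cocycle_mul g g h.zero_mem 0 i
  rw [h.map_zero g hp] at h1
  rw [h.map_zero g h.zero_mem] at h2
  simp only [Pi.pow_apply]
  rw [pow_two, pow_two, ← h1, ← h2, h.cocycle_eq_of_isPositiveAt (h.isPositiveAt_mul_self g) hp]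

end IsSystemAction

end

theorem Complex.log_mul_of_re_pos {x y : ℂ} (hx : 0 < x.re) (hy : 0 < y.re) :
    Complex.log (x * y) = Complex.log x + Complex.log y := by
  have ne_zero : ∀ w : ℂ, 0 < w.re → w ≠ 0 := by
    rintro w hw rfl
    exact lt_irrefl _ hw
  have h1 := abs_lt.1 (Complex.abs_arg_lt_pi_div_two_iff.2 (Or.inl hx))
  have h2 := abs_lt.1 (Complex.abs_arg_lt_pi_div_two_iff.2 (Or.inl hy))
  exact Complex.log_mul (ne_zero x hx) (ne_zero y hy) ⟨by linarith [h1.1, h2.1],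
    by linarith [h1.2, h2.2]⟩

namespace BlockModel

variable {ι V : Type} [Fintype ι] [NormedAddCommGroup V] [NormedSpace ℝ V] {M : BlockModel ι V}

theorem act_act {c d : ι → ℂ} (hc : ∀ i, (M.kind i).IsMultiplier (c i))
    (hd : ∀ i, (M.kind i).IsMultiplier (d i)) (z : V) :
    M.act c (M.act d z) = M.act (fun i => c i * d i) z := by
  have hcd : ∀ i, (M.kind i).IsMultiplier (c i * d i) := fun i => (hc i).mul (hd i)
  refine ext_coord (M := M) (fun i => ?_) fun i => ?_
  · rw [xi_act hc, xi_act hd, xi_act hcd, mul_assoc]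
  · rw [eta_act hc, eta_act hd, eta_act hcd, map_mul, mul_inv, mul_assoc]

theorem mom_act {c : ι → ℂ} (hc : ∀ i, (M.kind i).IsMultiplier (c i)) (z : V) (i : ι) :
    M.mom i (M.act c z) = M.mom i z := by
  have h := (hc i).conj_ne_zero
  rw [mom, mom, xi_act hc, eta_act hc, map_mul]
  field_simp

section Derivative

variable {f : V → V} {f' : V →L[ℝ] V} {z : V}

theorem xi_hasFDerivAt {i : ι} {β : V → ℂ} {β' : V →L[ℝ] ℂ} (hf : HasFDerivAt f f' z)
    (hβ : HasFDerivAt β β' z) (h : ∀ᶠ y in 𝓝 z, M.xi i (f y) = β y * M.xi i y) (u : V) :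
    M.xi i (f' u) = β z * M.xi i u + β' u * M.xi i z := by
  have h1 := (M.xi i).hasFDerivAt.comp z hf
  have h2 := (hβ.mul (M.xi i).hasFDerivAt).congr_of_eventuallyEq h
  have h3 := DFunLike.congr_fun (h1.unique h2) u
  simpa [mul_comm] using h3

theorem eta_hasFDerivAt {i : ι} {β : V → ℂ} {β' : V →L[ℝ] ℂ} (hf : HasFDerivAt f f' z)
    (hβ : HasFDerivAt β β' z) (h : ∀ᶠ y in 𝓝 z, conj (β y) * M.eta i (f y) = M.eta i y) (u : V) :
    conj (β z) * M.eta i (f' u) + conj (β' u) * M.eta i (f z) = M.eta i u := by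
  have h1 := (Complex.conjCLE.toContinuousLinearMap.hasFDerivAt.comp z hβ).mul
    ((M.eta i).hasFDerivAt.comp z hf)
  have h2 := (M.eta i).hasFDerivAt.congr_of_eventuallyEq h
  have h3 := DFunLike.congr_fun (h1.unique h2) u
  simpa [mul_comm] using h3

variable (M) in
/-- The change of the symplectic form under a map multiplying the blocks by functions with
logarithmic derivatives `ℓ`. -/
noncomputable def twist (z : V) (ℓ : ι → V →L[ℝ] ℂ) (u v : V) : ℝ :=
  ∑ i, (conj (ℓ i u) * (conj (M.xi i z) * M.eta i v + conj (M.xi i v) * M.eta i z) -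
    conj (ℓ i v) * (conj (M.xi i z) * M.eta i u + conj (M.xi i u) * M.eta i z)).re

theorem twist_sum {α : Type*} (s : Finset α) (z : V) (ℓ : α → ι → V →L[ℝ] ℂ) (u v : V) :
    M.twist z (fun i => ∑ a ∈ s, ℓ a i) u v = ∑ a ∈ s, M.twist z (ℓ a) u v := by
  simp only [twist]
  rw [Finset.sum_comm]
  refine Finset.sum_congr rfl fun i _ => ?_
  rw [← Complex.re_sum, Finset.sum_sub_distrib, ← Finset.sum_mul, ← Finset.sum_mul]
  simp

theorem twist_smul (r : ℝ) (z : V) (ℓ : ι → V →L[ℝ] ℂ) (u v : V) :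
    M.twist z (fun i => r • ℓ i) u v = r * M.twist z ℓ u v := by
  simp only [twist, Finset.mul_sum]
  refine Finset.sum_congr rfl fun i _ => ?_
  rw [← Complex.re_ofReal_mul]
  simp
  ring

theorem omega_hasFDerivAt {β : ι → V → ℂ} {ℓ : ι → V →L[ℝ] ℂ} (hf : HasFDerivAt f f' z)
    (hβ : ∀ i, HasFDerivAt (β i) (β i z • ℓ i) z) (hne : ∀ i, β i z ≠ 0)
    (hxi : ∀ i, ∀ᶠ y in 𝓝 z, M.xi i (f y) = β i y * M.xi i y)
    (heta : ∀ i, ∀ᶠ y in 𝓝 z, conj (β i y) * M.eta i (f y) = M.eta i y) (u v : V) :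
    M.omega (f' u) (f' v) = M.omega u v + M.twist z ℓ u v := by
  simp only [omega, twist, ← Finset.sum_add_distrib]
  refine Finset.sum_congr rfl fun i _ => ?_
  have hc : conj (β i z) ≠ 0 := (map_ne_zero _).2 (hne i)
  have hx : ∀ u, M.xi i (f' u) = β i z * (M.xi i u + ℓ i u * M.xi i z) := fun u => by
    rw [xi_hasFDerivAt hf (hβ i) (hxi i)]
    simp
    ring
  have he : ∀ u, M.eta i (f' u) = (conj (β i z))⁻¹ * (M.eta i u - conj (ℓ i u) * M.eta i z) := by
    intro u
    have h1 := eta_hasFDerivAt hf (hβ i) (heta i) u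
    have h2 := (heta i).self_of_nhds
    simp only [smul_apply, smul_eq_mul, map_mul] at h1
    rw [eq_inv_mul_iff_mul_eq₀ hc]
    linear_combination h1 - conj (ℓ i u) * h2
  have key : ∀ β a a' e e' : ℂ, β ≠ 0 → conj (β * a) * ((conj β)⁻¹ * e') -
      conj ((conj β)⁻¹ * e) * (β * a') = conj a * e' - conj e * a' := by
    intro β a a' e e' hβ
    have : conj β ≠ 0 := (map_ne_zero _).2 hβ
    simp only [map_mul, map_inv₀, Complex.conj_conj]
    field_simp
  rw [hx, hx, he, he, key _ _ _ _ _ (hne i)]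
  simp
  ring

end Derivative

end BlockModel

namespace IsSystemAction

open BlockModel

variable {ι V P : Type} [Fintype ι] [NormedAddCommGroup V] [NormedSpace ℝ V]
  [NormedAddCommGroup P] [NormedSpace ℝ P]
  {G : Type*} [Group G] [TopologicalSpace G] {M : BlockModel ι V}
  {B : Set P} {ρ : G → P → V → V} {b : G → ι → P × V → ℂ}

theorem exists_normal_isPositiveAt (h : IsSystemAction M B ρ b) :
    ∃ N : Subgroup G, N.Normal ∧ Finite (G ⧸ N) ∧ ∀ g ∈ N, IsPositiveAt M b g := by
  classical
  let σ : G →* (ι → SignType) :=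
    { toFun := fun g i => if M.kind i = .hyperbolic then SignType.sign (b g i (0, 0)).re else 1
      map_one' := by
        funext i
        simp [h.cocycle_one h.zero_mem]
      map_mul' := fun g g' => by
        funext i
        by_cases hκ : M.kind i = .hyperbolic
        · have h1 := h.isMultiplier g h.zero_mem 0 i
          have h2 := h.isMultiplier g' h.zero_mem 0 i
          rw [hκ] at h1 h2
          simp only [Pi.mul_apply, hκ, if_true]
          rw [h.cocycle_mul g g' h.zero_mem, h.map_zero g' h.zero_mem, Complex.mul_re, h1.2,
            zero_mul, sub_zero, sign_mul]
        · simp [hκ] }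
  refine ⟨σ.toHomUnits.ker, inferInstance, inferInstance, fun g hg i =>
    ⟨h.isMultiplier g h.zero_mem 0 i, fun hκ => ?_⟩⟩
  rw [MonoidHom.ker_toHomUnits, MonoidHom.mem_ker] at hg
  have h1 : (if M.kind i = .hyperbolic then SignType.sign (b g i (0, 0)).re else 1) = 1 :=
    congrFun hg i
  rw [if_pos hκ] at h1
  exact sign_eq_one_iff.1 h1

/-- The linear part of the action at the origin. -/
theorem fderiv_zero (h : IsSystemAction M B ρ b) (g : G) (w : V) :
    fderiv ℝ (ρ g 0) 0 w = M.act (fun i => b g i (0, 0)) w := by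
  have hd := ((h.contDiff_map g h.zero_mem).differentiable (by simp) 0).hasFDerivAt
  have hβ := fun i =>
    ((h.contDiff_cocycle g i h.zero_mem).differentiable (by simp) 0).hasFDerivAt
  have hm := fun i => h.isMultiplier g h.zero_mem 0 i
  refine ext_coord (M := M) (fun i => ?_) fun i => ?_
  · rw [xi_act hm, xi_hasFDerivAt hd (hβ i)
      (Eventually.of_forall fun y => h.xi_map g 0 h.zero_mem y i)]
    simp
  · rw [eta_act hm, eq_inv_mul_iff_mul_eq₀ (hm i).conj_ne_zero]
    have := eta_hasFDerivAt hd (hβ i)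
      (Eventually.of_forall fun y => h.conj_mul_eta_map g h.zero_mem y i) w
    simpa [h.map_zero g h.zero_mem] using this

/-- The logarithmic derivatives of the cocycle do not change the symplectic form. -/
theorem twist_cocycle (h : IsSystemAction M B ρ b) (g : G) {p : P} (hp : p ∈ B) (z u v : V) :
    M.twist z (fun i => (b g i (p, z))⁻¹ • fderiv ℝ (fun z => b g i (p, z)) z) u v = 0 := by
  have hd := ((h.contDiff_map g hp).differentiable (by simp) z).hasFDerivAt
  have h1 := omega_hasFDerivAt (M := M) (β := fun i z => b g i (p, z))
    (ℓ := fun i => (b g i (p, z))⁻¹ • fderiv ℝ (fun z => b g i (p, z)) z) hd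
    (fun i => by
      rw [smul_inv_smul₀ (h.cocycle_ne_zero g hp z i)]
      exact ((h.contDiff_cocycle g i hp).differentiable (by simp) z).hasFDerivAt)
    (fun i => h.cocycle_ne_zero g hp z i)
    (fun i => Eventually.of_forall fun y => h.xi_map g p hp y i)
    (fun i => Eventually.of_forall fun y => h.conj_mul_eta_map g hp y i) u v
  rw [h.omega_fderiv g p hp] at h1
  linarith

/-- The cocycle normalized to be trivial at the origin. -/
noncomputable def normalized (b : G → ι → P × V → ℂ) (g : G) (i : ι) (q : P × V) : ℂ :=
  b g i q / b g i (0, 0)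

theorem contDiffOn_normalized (h : IsSystemAction M B ρ b) (g : G) (i : ι) :
    ContDiffOn ℝ (⊤ : ℕ∞) (normalized b g i) (B ×ˢ univ) :=
  (h.contDiffOn_cocycle g i).div_const _

theorem isPositive_normalized (h : IsSystemAction M B ρ b) (g : G) {p : P} (hp : p ∈ B) (z : V)
    (i : ι) : (M.kind i).IsPositive (normalized b g i (p, z)) := by
  have h1 := h.isMultiplier g hp z i
  have h2 := h.isMultiplier g h.zero_mem 0 i
  refine ⟨by simpa only [normalized, div_eq_mul_inv] using h1.mul h2.inv, fun hκ => ?_⟩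
  have hiff := h.hyperbolic_re_pos_iff g hp z hκ
  rw [hκ] at h1 h2
  have e2 : b g i (0, 0) = ((b g i (0, 0)).re : ℂ) := Complex.ext rfl (by simpa using h2.2)
  have n1 : (b g i (p, z)).re ≠ 0 := fun h0 => h1.1 (Complex.ext h0 h1.2)
  have n2 : (b g i (0, 0)).re ≠ 0 := fun h0 => h2.1 (Complex.ext h0 h2.2)
  rw [normalized, e2, Complex.div_ofReal_re]
  by_cases hs : 0 < (b g i (p, z)).re
  · exact div_pos hs (hiff.1 hs)
  · exact div_pos_of_neg_of_neg (lt_of_le_of_ne (not_lt.1 hs) n1)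
      (lt_of_le_of_ne (not_lt.1 (mt hiff.2 hs)) n2)

theorem normalized_mul (h : IsSystemAction M B ρ b) (g g' : G) {p : P} (hp : p ∈ B) (z : V)
    (i : ι) : normalized b (g * g') i (p, z) =
      normalized b g i (p, ρ g' p z) * normalized b g' i (p, z) := by
  rw [normalized, normalized, normalized, h.cocycle_mul g g' hp,
    h.cocycle_mul g g' h.zero_mem, h.map_zero g' h.zero_mem, mul_div_mul_comm]

variable [FiniteDimensional ℝ V]

theorem normalized_act (h : IsSystemAction M B ρ b) (g : G) {p : P}
    (hp : p ∈ B) {c : ι → ℂ} (hc : ∀ i, (M.kind i).IsPositive (c i)) (z : V) (i : ι) :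
    normalized b g i (p, M.act c z) = normalized b g i (p, z) := by
  rw [normalized, normalized, h.cocycle_act g hp hc]

variable [CompactSpace G]

theorem normalized_zero (h : IsSystemAction M B ρ b) (g : G) {p : P} (hp : p ∈ B) (i : ι) :
    normalized b g i (p, 0) = 1 := by
  rw [normalized, h.cocycle_zero g hp, div_self (h.cocycle_ne_zero g h.zero_mem 0 i)]

theorem normalized_congr (h : IsSystemAction M B ρ b) {N : Subgroup G}
    (hN : ∀ g ∈ N, IsPositiveAt M b g) {g g' : G} (hg : (g : G ⧸ N) = g') {p : P} (hp : p ∈ B)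
    (z : V) (i : ι) : normalized b g i (p, z) = normalized b g' i (p, z) := by
  have hpos := hN _ (QuotientGroup.eq.1 hg)
  have h1 := h.cocycle_ne_zero (g⁻¹ * g') h.zero_mem 0 i
  rw [← mul_inv_cancel_left g g', normalized, normalized, h.cocycle_mul_of_isPositiveAt g hpos hp,
    h.cocycle_mul_of_isPositiveAt g hpos h.zero_mem, h.cocycle_eq_of_isPositiveAt hpos hp z i,
    mul_div_mul_right _ _ h1]

end IsSystemAction

namespace IsSystemAction

open BlockModel

variable {ι V P : Type} [Fintype ι] [NormedAddCommGroup V] [NormedSpace ℝ V]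
  [NormedAddCommGroup P] [NormedSpace ℝ P]
  {G : Type*} [Group G] [TopologicalSpace G] {M : BlockModel ι V}
  {B : Set P} {ρ : G → P → V → V} {b : G → ι → P × V → ℂ}

/-- The average over a finite quotient of the logarithms of the normalized cocycle. -/
noncomputable def averageLog (b : G → ι → P × V → ℂ) (N : Subgroup G) [Fintype (G ⧸ N)] (i : ι)
    (q : P × V) : ℂ :=
  (((Fintype.card (G ⧸ N) : ℝ)⁻¹ : ℝ) : ℂ) * ∑ a : G ⧸ N, Complex.log (normalized b a.out i q)

/-- The linearizing family of maps. -/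
noncomputable def linearization (M : BlockModel ι V) (b : G → ι → P × V → ℂ) (N : Subgroup G)
    [Fintype (G ⧸ N)] (p : P) (z : V) : V :=
  M.act (fun i => Complex.exp (averageLog b N i (p, z))) z

variable {N : Subgroup G} [Fintype (G ⧸ N)]

theorem isInfinitesimal_averageLog (h : IsSystemAction M B ρ b) {p : P} (hp : p ∈ B) (z : V)
    (i : ι) : (M.kind i).IsInfinitesimal (averageLog b N i (p, z)) :=
  (BlockKind.IsInfinitesimal.sum _ fun a _ =>
    (h.isPositive_normalized a.out hp z i).log).real_mul _

theorem isPositive_exp_averageLog (h : IsSystemAction M B ρ b) {p : P} (hp : p ∈ B) (z : V)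
    (i : ι) : (M.kind i).IsPositive (Complex.exp (averageLog b N i (p, z))) :=
  (h.isInfinitesimal_averageLog hp z i).exp

theorem xi_linearization (h : IsSystemAction M B ρ b) {p : P} (hp : p ∈ B) (z : V) (i : ι) :
    M.xi i (linearization M b N p z) = Complex.exp (averageLog b N i (p, z)) * M.xi i z :=
  xi_act (fun i => (h.isPositive_exp_averageLog hp z i).1) z i

theorem conj_mul_eta_linearization (h : IsSystemAction M B ρ b) {p : P} (hp : p ∈ B) (z : V)
    (i : ι) : conj (Complex.exp (averageLog b N i (p, z))) *
      M.eta i (linearization M b N p z) = M.eta i z := by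
  have h1 := fun i => (h.isPositive_exp_averageLog (N := N) hp z i).1
  rw [linearization, eta_act h1, mul_inv_cancel_left₀ (h1 i).conj_ne_zero]

theorem linearization_zero (h : IsSystemAction M B ρ b) {p : P} (hp : p ∈ B) :
    linearization M b N p 0 = 0 := by
  have h1 := fun i => (h.isPositive_exp_averageLog (N := N) hp 0 i).1
  exact ext_coord (M := M) (fun i => by simp [linearization, xi_act h1])
    fun i => by simp [linearization, eta_act h1]

theorem mom_linearization (h : IsSystemAction M B ρ b) {p : P} (hp : p ∈ B) (z : V) (i : ι) :
    M.mom i (linearization M b N p z) = M.mom i z :=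
  mom_act (fun i => (h.isPositive_exp_averageLog hp z i).1) z i

theorem contDiffOn_averageLog (h : IsSystemAction M B ρ b) {S : Set (P × V)}
    (hSB : S ⊆ B ×ˢ univ) (hS : ∀ q ∈ S, ∀ g i, 0 < (normalized b g i q).re) (i : ι) :
    ContDiffOn ℝ (⊤ : ℕ∞) (averageLog b N i) S := by
  refine contDiffOn_const.mul (ContDiffOn.sum fun a _ q hq => ?_)
  exact ((Complex.contDiffAt_log (Or.inl (hS q hq a.out i))).restrict_scalars
    ℝ).comp_contDiffWithinAt q (((h.contDiffOn_normalized a.out i).mono hSB) q hq)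

theorem contDiffOn_linearization (h : IsSystemAction M B ρ b) {S : Set (P × V)}
    (hSB : S ⊆ B ×ˢ univ) (hS : ∀ q ∈ S, ∀ g i, 0 < (normalized b g i q).re) :
    ContDiffOn ℝ (⊤ : ℕ∞) (fun q : P × V => linearization M b N q.1 q.2) S := by
  have h1 : ∀ i, ContDiffOn ℝ (⊤ : ℕ∞) (fun q : P × V => Complex.exp (averageLog b N i q)) S :=
    fun i => (h.contDiffOn_averageLog hSB hS i).cexp
  refine M.ofC.contDiff.comp_contDiffOn (contDiffOn_pi.2 fun i => ContDiffOn.prodMk ?_ ?_)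
  · exact (h1 i).mul ((M.xi i).contDiff.comp contDiff_snd).contDiffOn
  · refine ContDiffOn.mul (ContDiffOn.inv ?_ fun q _ => ?_)
      ((M.eta i).contDiff.comp contDiff_snd).contDiffOn
    · exact (Complex.conjCLE : ℂ →L[ℝ] ℂ).contDiff.comp_contDiffOn (h1 i)
    · exact (map_ne_zero _).2 (Complex.exp_ne_zero _)

theorem hasFDerivAt_averageLog (h : IsSystemAction M B ρ b) {p : P} (hp : p ∈ B) {z : V}
    (hz : ∀ g i, 0 < (normalized b g i (p, z)).re) (i : ι) :
    HasFDerivAt (fun z => averageLog b N i (p, z)) ((Fintype.card (G ⧸ N) : ℝ)⁻¹ •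
      ∑ a : G ⧸ N, (b a.out i (p, z))⁻¹ • fderiv ℝ (fun z => b a.out i (p, z)) z) z := by
  have h1 : ∀ a : G ⧸ N, HasFDerivAt (fun z => Complex.log (normalized b a.out i (p, z)))
      ((b a.out i (p, z))⁻¹ • fderiv ℝ (fun z => b a.out i (p, z)) z) z := by
    intro a
    have h2 := ((h.contDiff_cocycle a.out i hp).differentiable (by simp) z).hasFDerivAt.mul_const
      (b a.out i (0, 0))⁻¹
    have h3 := ((Complex.hasDerivAt_log (Or.inl (hz a.out i))).hasFDerivAt.restrictScalars ℝ).comp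
      z (f := fun z => normalized b a.out i (p, z))
      (by simpa only [normalized, div_eq_mul_inv] using h2)
    refine h3.congr_fderiv ?_
    have h4 := h.cocycle_ne_zero a.out h.zero_mem 0 i
    ext u
    simp [normalized]
    field_simp
  have h5 := (HasFDerivAt.fun_sum fun a (_ : a ∈ Finset.univ) => h1 a).const_smul
    (Fintype.card (G ⧸ N) : ℝ)⁻¹
  refine h5.congr_of_eventuallyEq (Eventually.of_forall fun y => ?_)
  simp [averageLog]

theorem omega_fderiv_linearization (h : IsSystemAction M B ρ b) {p : P} (hp : p ∈ B) {z : V}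
    (hz : ∀ g i, 0 < (normalized b g i (p, z)).re)
    (hd : DifferentiableAt ℝ (linearization M b N p) z) (u v : V) :
    M.omega (fderiv ℝ (linearization M b N p) z u) (fderiv ℝ (linearization M b N p) z v) =
      M.omega u v := by
  have h1 := omega_hasFDerivAt (M := M) (β := fun i z => Complex.exp (averageLog b N i (p, z)))
    hd.hasFDerivAt (fun i => (h.hasFDerivAt_averageLog hp hz i).cexp)
    (fun i => Complex.exp_ne_zero _)
    (fun i => Eventually.of_forall fun y => h.xi_linearization hp y i)
    (fun i => Eventually.of_forall fun y => h.conj_mul_eta_linearization hp y i) u v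
  rw [h1, twist_smul, twist_sum, Finset.sum_eq_zero fun a _ => h.twist_cocycle a.out hp z u v,
    mul_zero, add_zero]

variable [FiniteDimensional ℝ V]

theorem averageLog_act (h : IsSystemAction M B ρ b) {p : P}
    (hp : p ∈ B) {c : ι → ℂ} (hc : ∀ i, (M.kind i).IsPositive (c i)) (z : V) (i : ι) :
    averageLog b N i (p, M.act c z) = averageLog b N i (p, z) := by
  simp only [averageLog, h.normalized_act _ hp hc]

theorem injective_linearization (h : IsSystemAction M B ρ b) {p : P} (hp : p ∈ B) :
    Function.Injective (linearization M b N p) := by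
  intro z z' hzz
  have h1 := fun z i => h.isPositive_exp_averageLog (N := N) hp z i
  have hsub : ∀ i, (M.kind i).IsPositive
      (Complex.exp (averageLog b N i (p, z) - averageLog b N i (p, z'))) := fun i =>
    ((h.isInfinitesimal_averageLog hp z i).sub (h.isInfinitesimal_averageLog hp z' i)).exp
  have hneg : ∀ z i, (M.kind i).IsMultiplier (Complex.exp (-averageLog b N i (p, z))) :=
    fun z i => by
      rw [Complex.exp_neg]
      exact (h1 z i).1.inv
  have hact : ∀ z, M.act (fun i => Complex.exp (-averageLog b N i (p, z)))
      (linearization M b N p z) = z := fun z =>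
    ext_coord (M := M)
      (fun i => by
        rw [linearization, xi_act (hneg z), xi_act fun i => (h1 z i).1, Complex.exp_neg,
          inv_mul_cancel_left₀ (Complex.exp_ne_zero _)])
      fun i => by
        rw [linearization, eta_act (hneg z), eta_act fun i => (h1 z i).1, Complex.exp_neg,
          map_inv₀, inv_inv, mul_inv_cancel_left₀ (h1 z i).1.conj_ne_zero]
  have h2 : z' = M.act
      (fun i => Complex.exp (averageLog b N i (p, z) - averageLog b N i (p, z'))) z := by
    have h3 := hact z'
    rw [← hzz, linearization, act_act (hneg z') fun i => (h1 z i).1] at h3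
    simp only [← Complex.exp_add, neg_add_eq_sub] at h3
    exact h3.symm
  have h3 : ∀ i, averageLog b N i (p, z') = averageLog b N i (p, z) := fun i => by
    conv_lhs => rw [h2]
    exact h.averageLog_act hp hsub z i
  rw [← hact z, ← hact z', hzz]
  simp only [h3]

variable [CompactSpace G]

theorem averageLog_map [N.Normal] (h : IsSystemAction M B ρ b)
    (hN : ∀ g ∈ N, IsPositiveAt M b g) (g : G) {p : P} (hp : p ∈ B) {z : V}
    (hz : ∀ g i, 0 < (normalized b g i (p, z)).re)
    (hgz : ∀ g' i, 0 < (normalized b g' i (p, ρ g p z)).re) (i : ι) :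
    averageLog b N i (p, ρ g p z) =
      averageLog b N i (p, z) - Complex.log (normalized b g i (p, z)) := by
  have h1 : ∀ a : G ⧸ N, Complex.log (normalized b a.out i (p, ρ g p z)) =
      Complex.log (normalized b (a * (g : G ⧸ N)).out i (p, z)) -
        Complex.log (normalized b g i (p, z)) := by
    intro a
    rw [eq_sub_iff_add_eq, ← Complex.log_mul_of_re_pos (hgz _ i) (hz g i),
      ← h.normalized_mul a.out g hp]
    refine congrArg Complex.log (h.normalized_congr hN ?_ hp z i)
    rw [QuotientGroup.out_eq', QuotientGroup.mk_mul, QuotientGroup.out_eq']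
  have h2 : (Fintype.card (G ⧸ N) : ℂ) ≠ 0 := by
    exact_mod_cast Fintype.card_ne_zero
  have h3 := Equiv.sum_comp (Equiv.mulRight (g : G ⧸ N))
    fun a : G ⧸ N => Complex.log (normalized b a.out i (p, z))
  simp only [Equiv.coe_mulRight] at h3
  simp only [averageLog]
  rw [Finset.sum_congr rfl fun a _ => h1 a, Finset.sum_sub_distrib, h3]
  simp [mul_sub, h2]

theorem linearization_map [N.Normal] (h : IsSystemAction M B ρ b)
    (hN : ∀ g ∈ N, IsPositiveAt M b g) (g : G) {p : P} (hp : p ∈ B) {z : V}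
    (hz : ∀ g i, 0 < (normalized b g i (p, z)).re)
    (hgz : ∀ g' i, 0 < (normalized b g' i (p, ρ g p z)).re) :
    linearization M b N p (ρ g p z) = fderiv ℝ (ρ g 0) 0 (linearization M b N p z) := by
  have h1 := fun z i => (h.isPositive_exp_averageLog (N := N) hp z i).1
  rw [h.fderiv_zero, linearization, linearization,
    act_act (fun i => h.isMultiplier g h.zero_mem 0 i) (h1 z)]
  have h2 : (fun i => b g i (0, 0) * Complex.exp (averageLog b N i (p, z))) = fun i =>
      Complex.exp (averageLog b N i (p, ρ g p z)) * b g i (p, z) := by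
    funext i
    have h3 := h.cocycle_ne_zero g h.zero_mem 0 i
    have h4 := h.cocycle_ne_zero g hp z i
    have h5 : normalized b g i (p, z) ≠ 0 := div_ne_zero h4 h3
    rw [h.averageLog_map hN g hp hz hgz, Complex.exp_sub, Complex.exp_log h5, normalized]
    field_simp
  rw [h2, ← act_act (h1 _) fun i => h.isMultiplier g hp z i, ← h.map_eq_act g hp]

theorem exists_linearization (h : IsSystemAction M B ρ b) :
    ∃ ε > (0 : ℝ), ∃ Φ : P → V → V,
      ContDiffOn ℝ (⊤ : ℕ∞) (fun q : P × V => Φ q.1 q.2)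
        ((B ∩ Metric.ball 0 ε) ×ˢ Metric.ball 0 ε) ∧
      ∀ p ∈ B ∩ Metric.ball 0 ε, Φ p 0 = 0 ∧ InjOn (Φ p) (Metric.ball 0 ε) ∧
        (∀ z ∈ Metric.ball (0 : V) ε, ∀ u v,
          M.omega (fderiv ℝ (Φ p) z u) (fderiv ℝ (Φ p) z v) = M.omega u v) ∧
        (∀ z ∈ Metric.ball (0 : V) ε, ∀ i, M.mom i (Φ p z) = M.mom i z) ∧
        ∀ g, ∀ z ∈ Metric.ball (0 : V) ε, ρ g p z ∈ Metric.ball (0 : V) ε →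
          Φ p (ρ g p z) = fderiv ℝ (ρ g 0) 0 (Φ p z) := by
  obtain ⟨N, hnormal, hfin, hN⟩ := h.exists_normal_isPositiveAt
  let _ : Fintype (G ⧸ N) := Fintype.ofFinite (G ⧸ N)
  have hmem : B ×ˢ (univ : Set V) ∈ 𝓝 (0 : P × V) :=
    (h.isOpen.prod isOpen_univ).mem_nhds ⟨h.zero_mem, trivial⟩
  have hev : ∀ᶠ q in 𝓝 (0 : P × V), ∀ (a : G ⧸ N) (i : ι), 0 < (normalized b a.out i q).re := by
    refine eventually_all.2 fun a => eventually_all.2 fun i => ?_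
    have h1 : ContinuousAt (fun q => (normalized b a.out i q).re) (0 : P × V) :=
      Complex.continuous_re.continuousAt.comp
        ((h.contDiffOn_normalized a.out i).continuousOn.continuousAt hmem)
    refine h1.eventually_const_lt (?_ : 0 < (normalized b a.out i (0, 0)).re)
    rw [h.normalized_zero a.out h.zero_mem]
    exact one_pos
  obtain ⟨ε, hε, hball⟩ := Metric.mem_nhds_iff.1 hev
  have hpos : ∀ p ∈ B ∩ Metric.ball 0 ε, ∀ z ∈ Metric.ball (0 : V) ε, ∀ g i,
      0 < (normalized b g i (p, z)).re := by
    intro p hp z hz g i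
    rw [h.normalized_congr hN (QuotientGroup.out_eq' (g : G ⧸ N)).symm hp.1]
    refine hball ?_ _ i
    rw [← Prod.mk_zero_zero, ← ball_prod_same]
    exact ⟨hp.2, hz⟩
  have hsmooth : ContDiffOn ℝ (⊤ : ℕ∞) (fun q : P × V => linearization M b N q.1 q.2)
      ((B ∩ Metric.ball 0 ε) ×ˢ Metric.ball 0 ε) :=
    h.contDiffOn_linearization (fun q hq => ⟨hq.1.1, trivial⟩)
      fun q hq => hpos q.1 hq.1 q.2 hq.2
  refine ⟨ε, hε, linearization M b N, hsmooth, fun p hp => ⟨?_, ?_, fun z hz u v => ?_,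
    fun z _ i => ?_, fun g z hz hgz => ?_⟩⟩
  · exact h.linearization_zero hp.1
  · exact (h.injective_linearization hp.1).injOn
  · have hd : ContDiffOn ℝ (⊤ : ℕ∞) (linearization M b N p) (Metric.ball 0 ε) :=
      ContDiffOn.comp (g := fun q : P × V => linearization M b N q.1 q.2) (f := fun z => (p, z))
        hsmooth (contDiff_prodMk_right p).contDiffOn fun z hz => ⟨hp, hz⟩
    exact h.omega_fderiv_linearization hp.1 (hpos p hp z hz)
      ((hd.differentiableOn (by simp)).differentiableAt (Metric.isOpen_ball.mem_nhds hz)) u v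
  · exact h.mom_linearization hp.1 z i
  · exact h.linearization_map hN g hp.1 (hpos p hp z hz) (hpos p hp _ hgz)

end IsSystemAction

namespace Williamson

open BlockModel

variable (ke kh kf : ℕ)

/-- Position of a coordinate pair, indexed by block and place in the block. -/
def position : Fin ke ⊕ Fin kh ⊕ (Fin kf × Fin 2) → Fin (ke + kh + 2 * kf)
  | .inl i => ⟨i, by omega⟩
  | .inr (.inl i) => ⟨ke + i, by omega⟩
  | .inr (.inr (l, s)) => ⟨ke + kh + (2 * l + s), by omega⟩

/-- Coordinate pairs indexed by block and place in the block. -/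
noncomputable def positionEquiv :
    Fin ke ⊕ Fin kh ⊕ (Fin kf × Fin 2) ≃ Fin (ke + kh + 2 * kf) :=
  Equiv.ofBijective (position ke kh kf) <| by
    refine (Fintype.bijective_iff_injective_and_card _).2 ⟨?_, ?_⟩
    · rintro (i | i | ⟨i, s⟩) (j | j | ⟨j, t⟩) h <;>
        simp only [position, Sum.inl.injEq, Sum.inr.injEq, Prod.mk.injEq, reduceCtorEq,
          Fin.ext_iff] at h ⊢ <;> omega
    · simp
      omega

/-- The kind of each block. -/
def blockKind : Fin ke ⊕ Fin kh ⊕ Fin kf → BlockKind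
  | .inl _ => .elliptic
  | .inr (.inl _) => .hyperbolic
  | .inr (.inr _) => .focus

variable {ke kh kf}

/-- Complex coordinates of a block. -/
noncomputable def blockCoord (z : Fin (ke + kh + 2 * kf) → ℝ × ℝ) :
    Fin ke ⊕ Fin kh ⊕ Fin kf → ℂ × ℂ
  | .inl i => (⟨(z (positionEquiv ke kh kf (.inl i))).1, (z (positionEquiv ke kh kf (.inl i))).2⟩,
      ((-1 / 2 : ℝ) : ℂ) * (Complex.I *
        ⟨(z (positionEquiv ke kh kf (.inl i))).1, (z (positionEquiv ke kh kf (.inl i))).2⟩))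
  | .inr (.inl i) => ((z (positionEquiv ke kh kf (.inr (.inl i)))).1,
      (z (positionEquiv ke kh kf (.inr (.inl i)))).2)
  | .inr (.inr l) => (⟨(z (positionEquiv ke kh kf (.inr (.inr (l, 0))))).1,
      (z (positionEquiv ke kh kf (.inr (.inr (l, 1))))).1⟩,
      ⟨(z (positionEquiv ke kh kf (.inr (.inr (l, 0))))).2,
        (z (positionEquiv ke kh kf (.inr (.inr (l, 1))))).2⟩)

/-- Real coordinate pairs recovered from the complex coordinates of the blocks. -/
noncomputable def realCoord (w : Fin ke ⊕ Fin kh ⊕ Fin kf → ℂ × ℂ) :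
    Fin ke ⊕ Fin kh ⊕ (Fin kf × Fin 2) → ℝ × ℝ
  | .inl i => ((w (.inl i)).1.re, (w (.inl i)).1.im)
  | .inr (.inl i) => ((w (.inr (.inl i))).1.re, (w (.inr (.inl i))).2.re)
  | .inr (.inr (l, 0)) => ((w (.inr (.inr l))).1.re, (w (.inr (.inr l))).2.re)
  | .inr (.inr (l, 1)) => ((w (.inr (.inr l))).1.im, (w (.inr (.inr l))).2.im)

theorem realCoord_blockCoord (z : Fin (ke + kh + 2 * kf) → ℝ × ℝ) :
    realCoord (blockCoord z) = z ∘ positionEquiv ke kh kf := by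
  funext s
  rcases s with i | i | ⟨l, s⟩
  · rfl
  · rfl
  · fin_cases s <;> rfl

theorem blockCoord_realCoord {w : Fin ke ⊕ Fin kh ⊕ Fin kf → ℂ × ℂ}
    (hw : ∀ i, (blockKind ke kh kf i).Admissible (w i)) :
    blockCoord (realCoord w ∘ (positionEquiv ke kh kf).symm) = w := by
  funext i
  have h := hw i
  rcases i with i | i | l
  · simp only [blockCoord, Function.comp_apply, Equiv.symm_apply_apply, realCoord, Complex.eta]
    exact Prod.ext rfl h.symm
  · simp only [blockCoord, Function.comp_apply, Equiv.symm_apply_apply, realCoord]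
    exact Prod.ext (Complex.ext rfl h.1.symm) (Complex.ext rfl h.2.symm)
  · simp only [blockCoord, Function.comp_apply, Equiv.symm_apply_apply, realCoord, Complex.eta]

variable (ke kh kf) in
/-- The block model of a Williamson type. -/
noncomputable def model :
    BlockModel (Fin ke ⊕ Fin kh ⊕ Fin kf) (Fin (ke + kh + 2 * kf) → ℝ × ℝ) where
  kind := blockKind ke kh kf
  toC := LinearMap.toContinuousLinearMap
    { toFun := blockCoord
      map_add' := fun z z' => by
        funext i
        rcases i with i | i | l <;> refine Prod.ext (Complex.ext ?_ ?_) (Complex.ext ?_ ?_) <;>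
          simp [blockCoord] <;> ring
      map_smul' := fun r z => by
        funext i
        rcases i with i | i | l <;> refine Prod.ext (Complex.ext ?_ ?_) (Complex.ext ?_ ?_) <;>
          simp [blockCoord] <;> ring }
  ofC := LinearMap.toContinuousLinearMap
    { toFun := fun w => realCoord w ∘ (positionEquiv ke kh kf).symm
      map_add' := fun w w' => by
        funext j
        simp only [Function.comp_apply, Pi.add_apply]
        rcases (positionEquiv ke kh kf).symm j with i | i | ⟨l, s⟩
        · rfl
        · rfl
        · fin_cases s <;> rfl
      map_smul' := fun r w => by
        funext j
        simp only [Function.comp_apply, Pi.smul_apply]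
        rcases (positionEquiv ke kh kf).symm j with i | i | ⟨l, s⟩
        · simp [realCoord]
        · simp [realCoord]
        · fin_cases s <;> simp [realCoord] }
  ofC_toC := fun z => by
    change realCoord (blockCoord z) ∘ _ = z
    rw [realCoord_blockCoord, Function.comp_assoc, Equiv.self_comp_symm, Function.comp_id]
  toC_ofC := fun w hw => blockCoord_realCoord hw
  admissible := fun z i => by
    change (blockKind ke kh kf i).Admissible (blockCoord z i)
    rcases i with i | i | l
    · rfl
    · exact ⟨rfl, rfl⟩
    · trivial

theorem xi_model (i : Fin ke ⊕ Fin kh ⊕ Fin kf) (z : Fin (ke + kh + 2 * kf) → ℝ × ℝ) :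
    (model ke kh kf).xi i z = (blockCoord z i).1 := rfl

theorem eta_model (i : Fin ke ⊕ Fin kh ⊕ Fin kf) (z : Fin (ke + kh + 2 * kf) → ℝ × ℝ) :
    (model ke kh kf).eta i z = (blockCoord z i).2 := rfl

theorem omega_model (u v : Fin (ke + kh + 2 * kf) → ℝ × ℝ) :
    (model ke kh kf).omega u v = symplForm u v := by
  rw [symplForm, ← Equiv.sum_comp (positionEquiv ke kh kf)]
  simp only [omega, Fintype.sum_sum_type, Fintype.sum_prod_type, Fin.sum_univ_two, xi_model,
    eta_model, blockCoord]
  congr 1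
  · refine Finset.sum_congr rfl fun i _ => ?_
    have key : ∀ (r : ℝ) (a a' : ℂ), (conj a * (r * (Complex.I * a')) -
        conj (r * (Complex.I * a)) * a').re = -2 * r * (a.re * a'.im - a.im * a'.re) := by
      intro r a a'
      simp
      ring
    rw [key]
    ring
  · congr 1
    · refine Finset.sum_congr rfl fun i _ => ?_
      simp
    · refine Finset.sum_congr rfl fun i _ => ?_
      simp
      ring

theorem williamson_elliptic (i : Fin ke) (z : Fin (ke + kh + 2 * kf) → ℝ × ℝ) :
    williamson ke kh (positionEquiv ke kh kf (.inl i)) z =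
      (z (positionEquiv ke kh kf (.inl i))).1 ^ 2 +
        (z (positionEquiv ke kh kf (.inl i))).2 ^ 2 := by
  have h1 : (i : ℕ) < ke + kh + 2 * kf := by omega
  simp [williamson, positionEquiv, position, h1]

theorem williamson_hyperbolic (i : Fin kh) (z : Fin (ke + kh + 2 * kf) → ℝ × ℝ) :
    williamson ke kh (positionEquiv ke kh kf (.inr (.inl i))) z =
      (z (positionEquiv ke kh kf (.inr (.inl i)))).1 *
        (z (positionEquiv ke kh kf (.inr (.inl i)))).2 := by
  have h1 : ke + (i : ℕ) < ke + kh + 2 * kf := by omega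
  simp [williamson, positionEquiv, position, h1]

theorem williamson_focus_zero (l : Fin kf) (z : Fin (ke + kh + 2 * kf) → ℝ × ℝ) :
    williamson ke kh (positionEquiv ke kh kf (.inr (.inr (l, 0)))) z =
      (z (positionEquiv ke kh kf (.inr (.inr (l, 0))))).1 *
        (z (positionEquiv ke kh kf (.inr (.inr (l, 1))))).2 -
      (z (positionEquiv ke kh kf (.inr (.inr (l, 1))))).1 *
        (z (positionEquiv ke kh kf (.inr (.inr (l, 0))))).2 := by
  have h1 : ke + kh + 2 * (l : ℕ) < ke + kh + 2 * kf := by omega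
  have h2 : ke + kh + 2 * (l : ℕ) + 1 < ke + kh + 2 * kf := by omega
  have h3 : ¬ ke + kh + 2 * (l : ℕ) < ke := by omega
  have h4 : ¬ ke + kh + 2 * (l : ℕ) < ke + kh := by omega
  simp [williamson, positionEquiv, position, h1, h2, h3, h4, ← add_assoc]

theorem williamson_focus_one (l : Fin kf) (z : Fin (ke + kh + 2 * kf) → ℝ × ℝ) :
    williamson ke kh (positionEquiv ke kh kf (.inr (.inr (l, 1)))) z =
      (z (positionEquiv ke kh kf (.inr (.inr (l, 0))))).1 *
        (z (positionEquiv ke kh kf (.inr (.inr (l, 0))))).2 +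
      (z (positionEquiv ke kh kf (.inr (.inr (l, 1))))).1 *
        (z (positionEquiv ke kh kf (.inr (.inr (l, 1))))).2 := by
  have h1 : ke + kh + 2 * (l : ℕ) < ke + kh + 2 * kf := by omega
  have h2 : ke + kh + 2 * (l : ℕ) + 1 < ke + kh + 2 * kf := by omega
  have h3 : ¬ ke + kh + 2 * (l : ℕ) + 1 < ke := by omega
  have h4 : ¬ ke + kh + 2 * (l : ℕ) + 1 < ke + kh := by omega
  have h5 : (ke + kh + 2 * (l : ℕ) + 1 - (ke + kh)) % 2 = 1 := by omega
  simp [williamson, positionEquiv, position, h1, h2, h3, h4, h5, ← add_assoc]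

theorem forall_mom_model_eq_iff {z z' : Fin (ke + kh + 2 * kf) → ℝ × ℝ} :
    (∀ i, (model ke kh kf).mom i z = (model ke kh kf).mom i z') ↔
      ∀ j : Fin (ke + kh + 2 * kf), williamson ke kh j z = williamson ke kh j z' := by
  rw [← (positionEquiv ke kh kf).forall_congr_right]
  simp only [Sum.forall, Prod.forall, Fin.forall_fin_two, williamson_elliptic,
    williamson_hyperbolic, williamson_focus_zero, williamson_focus_one, mom, xi_model, eta_model,
    blockCoord]
  refine and_congr (forall_congr' fun i => ?_)
    (and_congr (forall_congr' fun i => ?_) (forall_congr' fun l => ?_))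
  · rw [Complex.ext_iff]
    simp
    constructor <;> intro h
    · linarith [h.2]
    · constructor <;> linarith
  · rw [Complex.ext_iff]
    simp
  · rw [Complex.ext_iff]
    simp
    constructor <;> intro h <;> constructor <;> linarith [h.1, h.2]

end Williamson

end

/-- Parametric equivariant linearization at a fixed point: a smooth
family, over a parameter ball `D^m`, of smooth system-preserving symplectic actions of a
compact (Lie) group `G` fixing `0 ∈ ℝ^{2k}` can be conjugated, by a smooth family of
local system-preserving symplectomorphisms `Φ_p`, to the parameter-free linear action
`D(ρ_0(g))(0)`. -/
theorem parametric_equivariant_linearization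
    (ke kh kf k : ℕ) (hk : k = ke + kh + 2 * kf)
    (m : ℕ) (R : ℝ) (hR : 0 < R)
    (G : Type*) [Group G] [TopologicalSpace G] [IsTopologicalGroup G] [CompactSpace G]
    (ρ : G → (Fin m → ℝ) → (Fin k → ℝ × ℝ) → (Fin k → ℝ × ℝ))
    (hcont : Continuous fun x : G × (Fin m → ℝ) × (Fin k → ℝ × ℝ) => ρ x.1 x.2.1 x.2.2)
    (hsmooth : ∀ g, ContDiffOn ℝ (⊤ : ℕ∞)
      (fun pz : (Fin m → ℝ) × (Fin k → ℝ × ℝ) => ρ g pz.1 pz.2)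
      (Metric.ball 0 R ×ˢ Set.univ))
    (hone : ∀ p ∈ Metric.ball (0 : Fin m → ℝ) R, ρ 1 p = id)
    (hmul : ∀ g₁ g₂, ∀ p ∈ Metric.ball (0 : Fin m → ℝ) R,
      ρ (g₁ * g₂) p = ρ g₁ p ∘ ρ g₂ p)
    (hfix : ∀ g, ∀ p ∈ Metric.ball (0 : Fin m → ℝ) R, ρ g p 0 = 0)
    (hsymp : ∀ g, ∀ p ∈ Metric.ball (0 : Fin m → ℝ) R, ∀ z,
      IsSymplecticCLM (fderiv ℝ (ρ g p) z))
    (hpres : ∀ g, ∀ p ∈ Metric.ball (0 : Fin m → ℝ) R, ∀ z (i : Fin k),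
      williamson ke kh i (ρ g p z) = williamson ke kh i z) :
    ∃ ε > (0 : ℝ), ∃ Φ : (Fin m → ℝ) → (Fin k → ℝ × ℝ) → (Fin k → ℝ × ℝ),
      ContDiffOn ℝ (⊤ : ℕ∞)
        (fun pz : (Fin m → ℝ) × (Fin k → ℝ × ℝ) => Φ pz.1 pz.2)
        ((Metric.ball 0 R ∩ Metric.ball 0 ε) ×ˢ Metric.ball 0 ε) ∧
      ∀ p ∈ Metric.ball (0 : Fin m → ℝ) R ∩ Metric.ball (0 : Fin m → ℝ) ε,
        Φ p 0 = 0 ∧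
        Set.InjOn (Φ p) (Metric.ball 0 ε) ∧
        (∀ z ∈ Metric.ball (0 : Fin k → ℝ × ℝ) ε, IsSymplecticCLM (fderiv ℝ (Φ p) z)) ∧
        (∀ z ∈ Metric.ball (0 : Fin k → ℝ × ℝ) ε, ∀ i : Fin k,
          williamson ke kh i (Φ p z) = williamson ke kh i z) ∧
        ∀ (g : G), ∀ z ∈ Metric.ball (0 : Fin k → ℝ × ℝ) ε,
          ρ g p z ∈ Metric.ball (0 : Fin k → ℝ × ℝ) ε →
            Φ p (ρ g p z) = fderiv ℝ (ρ g 0) 0 (Φ p z) := by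
  subst hk
  have homega : ∀ A : (Fin (ke + kh + 2 * kf) → ℝ × ℝ) →L[ℝ] (Fin (ke + kh + 2 * kf) → ℝ × ℝ),
      (∀ u v, (Williamson.model ke kh kf).omega (A u) (A v) =
        (Williamson.model ke kh kf).omega u v) ↔ IsSymplecticCLM A := fun A => by
    simp only [Williamson.omega_model, IsSymplecticCLM]
  choose b hb hxi using fun g i => BlockModel.exists_multiplier (M := Williamson.model ke kh kf)
    Metric.isOpen_ball (hsmooth g) (fun p hp z => (homega _).2 (hsymp g p hp z))
    (fun p hp i z => Williamson.forall_mom_model_eq_iff.2 (hpres g p hp z) i) i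
  have h : IsSystemAction (Williamson.model ke kh kf) (Metric.ball 0 R) ρ b :=
    { isOpen := Metric.isOpen_ball
      convex := convex_ball 0 R
      zero_mem := Metric.mem_ball_self hR
      continuous := hcont
      contDiffOn := hsmooth
      one := hone
      mul := hmul
      omega_fderiv := fun g p hp z => (homega _).2 (hsymp g p hp z)
      mom_map := fun g p hp i z => Williamson.forall_mom_model_eq_iff.2 (hpres g p hp z) i
      contDiffOn_cocycle := hb
      xi_map := fun g p hp z i => hxi g i p hp z }
  obtain ⟨ε, hε, Φ, hΦ, hprop⟩ := h.exists_linearization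
  refine ⟨ε, hε, Φ, hΦ, fun p hp => ?_⟩
  obtain ⟨h0, hinj, hom, hmom, hequiv⟩ := hprop p hp
  exact ⟨h0, hinj, fun z hz => (homega _).1 (hom z hz),
    fun z hz => Williamson.forall_mom_model_eq_iff.1 (hmom z hz), hequiv⟩
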